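/- arXiv:2007.05725 — 2 statements merged into one kernel-verified Lean document; each statement's English description precedes it below -/
import Mathlib

section
/- Let μ_n = H¹⌊S_n where each S_n ⊂ K is a closed connected subset of a compact set K ⊂ ℝ² with H¹(S_n) ≤ L. Suppose S_n → S in the Hausdorff distance and μ_n ⇀* μ. Then S is closed and connected, μ ≥ H¹⌊S, and H¹(S) ≤ L. -/
open MeasureTheory Filter Topology

namespace Golab
open Metric
open scoped ENNReal

section density
variable {X : Type*} [MetricSpace X] [MeasurableSpace X] [BorelSpace X]

lemma vitali_cover (ν : Measure X) [IsFiniteMeasure ν] {E G : Set X}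
    (hG : IsOpen G) (hEG : E ⊆ G) {θ : ℝ} (hθ : 0 < θ)
    (h : ∀ x ∈ E, ∀ δ > 0, ∃ U : Set X, IsClosed U ∧ x ∈ U ∧ 0 < diam U ∧ diam U < δ ∧
      ENNReal.ofReal (θ * diam U) ≤ ν U) {δ : ℝ} (hδ : 0 < δ) {η : ℝ≥0∞} (hη : 0 < η) :
    ∃ (u : Set (Set X)) (W : u → Set X), u.Countable ∧ (∀ b, ediam (W b) ≤ ENNReal.ofReal (6 * δ)) ∧
      E ⊆ ⋃ b, W b ∧ ∑' b, ediam (W b) ≤ ν G / ENNReal.ofReal θ + 6 * η := by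
  classical
  let t : Set (Set X) := {U | IsClosed U ∧ U ⊆ G ∧ 0 < diam U ∧ diam U < δ ∧
      ENNReal.ofReal (θ * diam U) ≤ ν U}
  have hbd : ∀ U : Set X, 0 < diam U → Bornology.IsBounded U := by
    intro U hU
    by_contra hb
    rw [diam_eq_zero_of_unbounded hb] at hU
    exact lt_irrefl _ hU
  have hed : ∀ U : Set X, 0 < diam U → ediam U = ENNReal.ofReal (diam U) := by
    intro U hU
    rw [diam, ENNReal.ofReal_toReal (hbd U hU).ediam_ne_top]
  have hne : ∀ U : Set X, 0 < diam U → U.Nonempty := by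
    intro U hU
    by_contra hb
    rw [Set.not_nonempty_iff_eq_empty] at hb
    simp [hb] at hU
  have key : ∀ x ∈ E, ∀ O, IsOpen O → x ∈ O → ∃ U ∈ t, x ∈ U ∧ U ⊆ O := by
    intro x hx O hO hxO
    obtain ⟨r, hr, hrO⟩ := Metric.isOpen_iff.1 (hO.inter hG) x ⟨hxO, hEG hx⟩
    obtain ⟨U, h1, h2, h3, h4, h5⟩ := h x hx (min r δ) (lt_min hr hδ)
    have hsub : U ⊆ O ∩ G := by
      intro y hy
      apply hrO
      exact lt_of_le_of_lt (dist_le_diam_of_mem (hbd U h3) hy h2) (lt_of_lt_of_le h4 (min_le_left _ _))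
    exact ⟨U, ⟨h1, fun y hy => (hsub hy).2, h3, lt_of_lt_of_le h4 (min_le_right _ _), h5⟩, h2,
      fun y hy => (hsub hy).1⟩
  obtain ⟨u, hut, hdisj, hcov⟩ := Vitali.exists_disjoint_subfamily_covering_enlargement
    (fun U : Set X => U) t (fun U => diam U) 2 (by norm_num) (fun a _ => diam_nonneg) δ
    (fun a ha => ha.2.2.2.1.le) (fun a ha => hne a ha.2.2.1)
  have hpos : ∀ b : u, 0 < ν b := fun b =>
    lt_of_lt_of_le (ENNReal.ofReal_pos.2 (mul_pos hθ (hut b.2).2.2.1)) (hut b.2).2.2.2.2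
  have hdj : Pairwise (Function.onFun Disjoint (fun b : u => (b : Set X))) := by
    intro a b hab
    exact hdisj a.2 b.2 (fun hh => hab (Subtype.ext hh))
  have hms : ∀ b : u, MeasurableSet (b : Set X) := fun b => (hut b.2).1.measurableSet
  have hcount : u.Countable := by
    have := Measure.countable_meas_pos_of_disjoint_iUnion (μ := ν) hms hdj
    have h2 : {i : u | 0 < ν (i : Set X)} = Set.univ := by
      ext i; simpa using hpos i
    rw [h2] at this
    exact Set.countable_coe_iff.1 (Set.countable_univ_iff.1 this)
  have hsum : ∑' b : u, ediam (b : Set X) ≤ ν G / ENNReal.ofReal θ := by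
    rw [ENNReal.le_div_iff_mul_le (Or.inl (ENNReal.ofReal_pos.2 hθ).ne')
      (Or.inl ENNReal.ofReal_ne_top), ← ENNReal.tsum_mul_right]
    calc ∑' b : u, ediam (b : Set X) * ENNReal.ofReal θ ≤ ∑' b : u, ν b := by
          apply ENNReal.tsum_le_tsum
          intro b
          rw [hed _ (hut b.2).2.2.1, mul_comm, ← ENNReal.ofReal_mul hθ.le]
          exact (hut b.2).2.2.2.2
      _ ≤ ν (⋃ b : u, (b : Set X)) := tsum_meas_le_meas_iUnion_of_disjoint ν hms hdj
      _ ≤ ν G := measure_mono (Set.iUnion_subset fun b => (hut b.2).2.1)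
  have hfin : ∑' b : u, ediam (b : Set X) ≠ ⊤ := by
    refine ne_top_of_le_ne_top ?_ hsum
    exact ENNReal.div_ne_top (measure_ne_top _ _) (ENNReal.ofReal_pos.2 hθ).ne'
  obtain ⟨F, hF⟩ := ((ENNReal.tendsto_tsum_compl_atTop_zero hfin).eventually
    (ge_mem_nhds hη)).exists
  choose p hp using fun (b : u) => hne b (hut b.2).2.2.1
  let W : u → Set X := fun b => if b ∈ F then (b : Set X) else closedBall (p b) (3 * diam (b : Set X))
  have hW6 : ∀ b : u, ediam (closedBall (p b) (3 * diam (b : Set X))) ≤ 6 * ediam (b : Set X) := by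
    intro b
    rw [hed _ (hut b.2).2.2.1]
    have : (6 : ℝ≥0∞) = ENNReal.ofReal 6 := by norm_num
    rw [this, ← ENNReal.ofReal_mul (by norm_num)]
    apply ediam_le_of_forall_dist_le
    intro y hy z hz
    have := dist_triangle_right y z (p b)
    rw [mem_closedBall] at hy hz
    linarith
  have h16 : ∀ b : u, ediam (b : Set X) ≤ 6 * ediam (b : Set X) := fun b => by
    conv_lhs => rw [← one_mul (ediam (b : Set X))]
    gcongr
    norm_num
  refine ⟨u, W, hcount, ?_, ?_, ?_⟩
  · intro b
    have : ediam (W b) ≤ 6 * ediam (b : Set X) := by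
      simp only [W]
      split_ifs
      · exact h16 b
      · exact hW6 b
    refine this.trans ?_
    rw [hed _ (hut b.2).2.2.1, ENNReal.ofReal_mul (by norm_num)]
    gcongr
    · norm_num
    · exact (hut b.2).2.2.2.1.le
  · intro x hx
    by_cases hxF : ∃ b ∈ F, x ∈ (b : Set X)
    · obtain ⟨b, hb, hxb⟩ := hxF
      refine Set.mem_iUnion.2 ⟨b, ?_⟩
      simp only [W, hb, if_true, hxb]
    · push Not at hxF
      have hcl : IsClosed (⋃ b ∈ F, (b : Set X)) :=
        F.finite_toSet.isClosed_biUnion (fun b _ => (hut b.2).1)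
      obtain ⟨a, hat, hxa, haO⟩ := key x hx _ hcl.isOpen_compl (by simpa using hxF)
      obtain ⟨b, hb, ⟨z, hza, hzb⟩, hdab⟩ := hcov a hat
      have hbF : (⟨b, hb⟩ : u) ∉ F := by
        intro hbF
        apply haO hza
        exact Set.mem_biUnion hbF hzb
      refine Set.mem_iUnion.2 ⟨⟨b, hb⟩, ?_⟩
      simp only [W, hbF, if_false, mem_closedBall]
      have e1 := dist_le_diam_of_mem (hbd a hat.2.2.1) hxa hza
      have e2 := dist_le_diam_of_mem (hbd b (hut hb).2.2.1) hzb (hp ⟨b, hb⟩)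
      have := dist_triangle x z (p ⟨b, hb⟩)
      linarith
  · have hb1 : ∀ b, ediam (W b) ≤ ediam (b : Set X) +
        6 * (({x | x ∉ F} : Set u).indicator (fun b : u => ediam (b : Set X)) b) := by
      intro b
      by_cases hb : b ∈ F
      · simp [W, hb]
      · simp only [W, hb, if_false]
        refine (hW6 b).trans ?_
        simp [Set.indicator, hb]
    refine (ENNReal.tsum_le_tsum hb1).trans ?_
    rw [ENNReal.tsum_add, ENNReal.tsum_mul_left, ← tsum_subtype]
    gcongr
    exact hF

lemma density_lower (ν : Measure X) [IsFiniteMeasure ν] {E : Set X} {θ : ℝ} (hθ : 0 < θ)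
    (h : ∀ x ∈ E, ∀ δ > 0, ∃ U : Set X, IsClosed U ∧ x ∈ U ∧ 0 < diam U ∧ diam U < δ ∧
      ENNReal.ofReal (θ * diam U) ≤ ν U) :
    ENNReal.ofReal θ * μH[1] E ≤ ν E := by
  refine le_of_forall_gt fun c hc => ?_
  obtain ⟨G, hEG, hG, hGc⟩ := E.exists_isOpen_lt_of_lt c hc
  refine lt_of_le_of_lt ?_ hGc
  have hn : ∀ n : ℕ, (0 : ℝ) < 1 / ((n : ℝ) + 1) := fun n => by positivity
  have hn' : ∀ n : ℕ, (0 : ℝ≥0∞) < ((n : ℝ≥0∞) + 1)⁻¹ := fun n => by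
    simp
  choose u W hu hW hE hs using fun n : ℕ => vitali_cover ν hG hEG hθ h (hn n) (hn' n)
  have hc : ∀ n, Countable (u n) := fun n => (hu n).to_subtype
  have hlim : Tendsto (fun n : ℕ => ((n : ℝ≥0∞) + 1)⁻¹) atTop (𝓝 0) := by
    have := ENNReal.tendsto_inv_nat_nhds_zero.comp (tendsto_add_atTop_nat 1)
    refine this.congr fun n => ?_
    simp
  have h1 := Measure.hausdorffMeasure_le_liminf_tsum (X := X) (ι := fun n => u n) 1 E (l := atTop)
    (fun n : ℕ => ENNReal.ofReal (6 * (1 / ((n : ℝ) + 1))))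
    (by
      have : Tendsto (fun n : ℕ => 6 * (1 / ((n : ℝ) + 1))) atTop (𝓝 (6 * 0)) :=
        tendsto_one_div_add_atTop_nhds_zero_nat.const_mul 6
      simpa using ENNReal.tendsto_ofReal this)
    W (Eventually.of_forall hW) (Eventually.of_forall hE)
  have h2 : μH[1] E ≤ ν G / ENNReal.ofReal θ := by
    refine h1.trans ?_
    simp only [ENNReal.rpow_one]
    have h3 : Tendsto (fun n : ℕ => ν G / ENNReal.ofReal θ + 6 * ((n : ℝ≥0∞) + 1)⁻¹) atTop
        (𝓝 (ν G / ENNReal.ofReal θ + 6 * 0)) :=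
      tendsto_const_nhds.add (ENNReal.Tendsto.const_mul hlim (Or.inr (by norm_num)))
    rw [mul_zero, add_zero] at h3
    rw [← h3.liminf_eq]
    exact liminf_le_liminf (Eventually.of_forall hs)
  rw [mul_comm]
  exact (ENNReal.le_div_iff_mul_le (Or.inl (ENNReal.ofReal_pos.2 hθ).ne')
      (Or.inl ENNReal.ofReal_ne_top)).1 h2

/-- upper convex density -/
lemma density_upper {S : Set X} (hfin : μH[1] S ≠ ⊤) :
    ∃ N : Set X, μH[1] N = 0 ∧ ∀ x ∈ S, x ∉ N → ∀ ε > 0, ∃ δ > 0, ∀ U : Set X, IsClosed U → x ∈ U →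
      0 < diam U → diam U < δ → μH[1] (S ∩ U) ≤ ENNReal.ofReal ((1 + ε) * diam U) := by
  let B : ℝ → Set X := fun ε => {x | x ∈ S ∧ ∀ δ > 0, ∃ U : Set X, IsClosed U ∧ x ∈ U ∧
      0 < diam U ∧ diam U < δ ∧ ENNReal.ofReal ((1 + ε) * diam U) ≤ μH[1].restrict S U}
  have : IsFiniteMeasure (μH[1].restrict S : Measure X) :=
    ⟨by simpa using hfin.lt_top⟩
  have hB : ∀ ε > 0, μH[1] (B ε) = 0 := by
    intro ε hε
    have h1 := density_lower (μH[1].restrict S) (E := B ε) (θ := 1 + ε) (by linarith)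
      (fun x hx => hx.2)
    have h2 : μH[1].restrict S (B ε) ≤ μH[1] (B ε) := Measure.restrict_apply_le _ _
    have h3 : μH[1] (B ε) ≠ ⊤ := ne_top_of_le_ne_top hfin (measure_mono fun x hx => hx.1)
    by_contra h0
    have h4 := h1.trans h2
    have h5 : 1 * μH[1] (B ε) < ENNReal.ofReal (1 + ε) * μH[1] (B ε) := by
      apply ENNReal.mul_lt_mul_left h0 h3
      rw [← ENNReal.ofReal_one]
      exact (ENNReal.ofReal_lt_ofReal_iff (by linarith)).2 (by linarith)
    rw [one_mul] at h5
    exact absurd h4 (not_le.2 h5)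
  refine ⟨⋃ n : ℕ, B (1 / ((n : ℝ) + 1)), measure_iUnion_null fun n => hB _ (by positivity), ?_⟩
  intro x hx hxN ε hε
  obtain ⟨n, hn⟩ := exists_nat_one_div_lt hε
  have hxn : x ∉ B (1 / ((n : ℝ) + 1)) := fun hh => hxN (Set.mem_iUnion.2 ⟨n, hh⟩)
  simp only [B, Set.mem_ofPred_eq, not_and, not_forall, not_exists] at hxn
  obtain ⟨δ, hδ, hh⟩ := hxn hx
  refine ⟨δ, hδ, fun U h1 h2 h3 h4 => ?_⟩
  have h5 := not_le.1 (hh U h1 h2 h3 h4)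
  rw [Measure.restrict_apply h1.measurableSet, Set.inter_comm] at h5
  refine h5.le.trans (ENNReal.ofReal_le_ofReal ?_)
  gcongr

/-- basic lower bound -/
lemma ball_lower {T : Set X} (hT : IsPreconnected T) {x y z : X} {s r : ℝ} (hy : y ∈ T)
    (hz : z ∈ T) (hys : dist y x ≤ s) (hzr : r ≤ dist z x) :
    ENNReal.ofReal (r - s) ≤ μH[1] (T ∩ ball x r) := by
  have h1 : Set.Ioo s r ⊆ (fun w => dist w x) '' (T ∩ ball x r) := by
    intro c hc
    obtain ⟨w, hw, hwc⟩ := hT.intermediate_value hy hz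
      (f := fun w => dist w x) (by fun_prop) ⟨hys.trans hc.1.le, hc.2.le.trans hzr⟩
    exact ⟨w, ⟨hw, by simpa [hwc] using hc.2⟩, hwc⟩
  have h2 := (LipschitzWith.dist_left x).hausdorffMeasure_image_le (d := 1) zero_le_one (T ∩ ball x r)
  simp only [ENNReal.coe_one, ENNReal.one_rpow, one_mul] at h2
  refine le_trans ?_ h2
  rw [hausdorffMeasure_real, ← Real.volume_Ioo]
  exact measure_mono h1

end density
end Golab

namespace Golab
open Metric
open scoped ENNReal

section perim
variable {X : Type*} [MetricSpace X] [MeasurableSpace X] [BorelSpace X]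

lemma perim {C : Set X} (hC : IsPreconnected C) {x y a : X} (hx : x ∈ C) (hy : y ∈ C) (ha : a ∈ C)
    {M : ℝ} (hM : 0 ≤ M) (hH : μH[1] C ≤ ENNReal.ofReal M) :
    dist x y + dist y a + dist a x ≤ 2 * M := by
  have t1 := dist_triangle x y a
  have t2 := dist_triangle y a x
  have t3 := dist_triangle a x y
  rw [dist_comm x a] at t1
  rw [dist_comm y x] at t2
  rw [dist_comm a y] at t3
  set ρx := (dist x y + dist a x - dist y a) / 2 with hρx
  set ρy := (dist x y + dist y a - dist a x) / 2 with hρy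
  set ρa := (dist a x + dist y a - dist x y) / 2 with hρa
  have b1 := ball_lower hC hx hy (x := x) (s := 0) (r := ρx) (by simp)
    (by rw [dist_comm y x]; linarith)
  have b2 := ball_lower hC hy hx (x := y) (s := 0) (r := ρy) (by simp) (by linarith)
  have b3 := ball_lower hC ha hx (x := a) (s := 0) (r := ρa) (by simp)
    (by rw [dist_comm x a]; linarith)
  rw [sub_zero] at b1 b2 b3
  have d1 : Disjoint (ball x ρx) (ball y ρy) := ball_disjoint_ball (by linarith)
  have d2 : Disjoint (ball x ρx) (ball a ρa) := ball_disjoint_ball (by rw [dist_comm]; linarith)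
  have d3 : Disjoint (ball y ρy) (ball a ρa) := ball_disjoint_ball (by linarith)
  have e : ∀ z r, μH[1] (C ∩ ball z r) = (μH[1].restrict C) (ball z r) := fun z r => by
    rw [Measure.restrict_apply measurableSet_ball, Set.inter_comm]
  rw [e] at b1 b2 b3
  have hs : ENNReal.ofReal (ρx + ρy + ρa) ≤ ENNReal.ofReal M := by
    rw [ENNReal.ofReal_add (by linarith) (by linarith), ENNReal.ofReal_add (by linarith) (by linarith)]
    refine (add_le_add (add_le_add b1 b2) b3).trans ?_
    rw [← measure_union d1 measurableSet_ball,
      ← measure_union (d2.union_left d3) measurableSet_ball]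
    refine (measure_mono (Set.subset_univ _)).trans ?_
    rwa [Measure.restrict_apply_univ]
  have := (ENNReal.ofReal_le_ofReal_iff hM).1 hs
  linarith

lemma dist_le_length {C : Set X} (hC : IsPreconnected C) {x y : X} (hx : x ∈ C) (hy : y ∈ C)
    {M : ℝ} (hM : 0 ≤ M) (hH : μH[1] C ≤ ENNReal.ofReal M) : dist x y ≤ M := by
  have := perim hC hx hy hy hM hH
  rw [dist_self, dist_comm y x] at this
  linarith

end perim

section local_est
variable {E : Type*} [NormedAddCommGroup E] [InnerProductSpace ℝ E] [MeasurableSpace E] [BorelSpace E]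

local notation "⟪" a ", " b "⟫" => inner ℝ a b

lemma inner_le_dist {e : E} (he : ‖e‖ = 1) (u v : E) : ⟪u, e⟫ - ⟪v, e⟫ ≤ dist u v := by
  rw [← inner_sub_left, dist_eq_norm]
  have := real_inner_le_norm (u - v) e
  rwa [he, mul_one] at this

/-- structure of a continuum near a point of density one inside an arc -/
lemma local_structure {S C₁ C₂ : Set E} {x p₁ p₂ : E} {R ε : ℝ} (hR : 0 < R) (hε : 0 < ε)
    (hε1 : ε ≤ 1 / 100) (hS : IsPreconnected S)
    (h1S : C₁ ⊆ S) (h2S : C₂ ⊆ S) (h1R : C₁ ⊆ closedBall x R) (h2R : C₂ ⊆ closedBall x R)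
    (h1c : IsPreconnected C₁) (h2c : IsPreconnected C₂) (h1cl : IsClosed C₁) (h2cl : IsClosed C₂)
    (hx1 : x ∈ C₁) (hx2 : x ∈ C₂) (h12 : μH[1] (C₁ ∩ C₂) = 0)
    (hp1 : p₁ ∈ C₁) (hp2 : p₂ ∈ C₂) (hp1R : dist p₁ x = R) (hp2R : dist p₂ x = R)
    (hd1 : ∀ U : Set E, IsClosed U → x ∈ U → 0 < diam U → diam U ≤ 2 * R →
      μH[1] (S ∩ U) ≤ ENNReal.ofReal ((1 + ε) * diam U)) :
    ∃ e : E, ‖e‖ = 1 ∧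
      (∀ w ∈ S, dist w x ≤ R / 2 + ε * R → dist w x - 18 * (ε * R) ≤ |⟪w - x, e⟫|) ∧
      (∀ ρ, 0 ≤ ρ → ρ ≤ R → ∃ y ∈ S, dist y x = ρ ∧ ⟪y - x, e⟫ ≤ - ρ + 12 * (ε * R)) ∧
      (∀ ρ, 0 ≤ ρ → ρ ≤ R → ∃ y ∈ S, dist y x = ρ ∧ ρ - 12 * (ε * R) ≤ ⟪y - x, e⟫) := by
  have hεR : 0 < ε * R := mul_pos hε hR
  have hεR1 : ε * R ≤ R / 100 := by nlinarith
  set V := C₁ ∪ C₂ with hV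
  have hVcl : IsClosed V := h1cl.union h2cl
  have hVR : V ⊆ closedBall x R := Set.union_subset h1R h2R
  have hVS : V ⊆ S := Set.union_subset h1S h2S
  have hVb : Bornology.IsBounded V := isBounded_closedBall.subset hVR
  have hVd : diam V ≤ 2 * R := diam_le_of_subset_closedBall hR.le hVR
  have hVpos : 0 < diam V := by
    have := dist_le_diam_of_mem hVb (Or.inl hp1 : p₁ ∈ V) (Or.inl hx1 : x ∈ V)
    linarith
  have hμV := hd1 V hVcl (Or.inl hx1) hVpos hVd
  rw [Set.inter_eq_right.2 hVS] at hμV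
  -- lengths
  have l1 : ENNReal.ofReal R ≤ μH[1] C₁ := by
    have := ball_lower h1c hx1 hp1 (x := x) (s := 0) (r := R) (by simp) hp1R.ge
    rw [sub_zero] at this
    exact this.trans (measure_mono Set.inter_subset_left)
  have l2 : ENNReal.ofReal R ≤ μH[1] C₂ := by
    have := ball_lower h2c hx2 hp2 (x := x) (s := 0) (r := R) (by simp) hp2R.ge
    rw [sub_zero] at this
    exact this.trans (measure_mono Set.inter_subset_left)
  have hadd : μH[1] C₁ + μH[1] C₂ = μH[1] V := by
    rw [← measure_union_add_inter C₁ h2cl.measurableSet, h12, add_zero]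
  have hVtop : μH[1] V ≠ ⊤ := ne_top_of_le_ne_top ENNReal.ofReal_ne_top hμV
  have h1top : μH[1] C₁ ≠ ⊤ := ne_top_of_le_ne_top hVtop (measure_mono Set.subset_union_left)
  have h2top : μH[1] C₂ ≠ ⊤ := ne_top_of_le_ne_top hVtop (measure_mono Set.subset_union_right)
  obtain ⟨c₁, hc1⟩ : ∃ c, c = (μH[1] C₁).toReal := ⟨_, rfl⟩
  obtain ⟨c₂, hc2⟩ : ∃ c, c = (μH[1] C₂).toReal := ⟨_, rfl⟩
  have hc1' : μH[1] C₁ = ENNReal.ofReal c₁ := by rw [hc1, ENNReal.ofReal_toReal h1top]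
  have hc2' : μH[1] C₂ = ENNReal.ofReal c₂ := by rw [hc2, ENNReal.ofReal_toReal h2top]
  have hc1n : 0 ≤ c₁ := by rw [hc1]; exact ENNReal.toReal_nonneg
  have hc2n : 0 ≤ c₂ := by rw [hc2]; exact ENNReal.toReal_nonneg
  rw [hc1'] at l1
  rw [hc2'] at l2
  rw [ENNReal.ofReal_le_ofReal_iff hc1n] at l1
  rw [ENNReal.ofReal_le_ofReal_iff hc2n] at l2
  have hVeq : μH[1] V = ENNReal.ofReal (c₁ + c₂) := by
    rw [← hadd, hc1', hc2', ENNReal.ofReal_add hc1n hc2n]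
  rw [hVeq, ENNReal.ofReal_le_ofReal_iff (by positivity)] at hμV
  have hsum : c₁ + c₂ ≤ 2 * R + 2 * (ε * R) := by nlinarith
  have hdV : 2 * R - 4 * (ε * R) < diam V := by
    by_contra hcon
    push Not at hcon
    have : (1 + ε) * diam V ≤ (1 + ε) * (2 * R - 4 * (ε * R)) := by gcongr
    nlinarith
  obtain ⟨a₀, ha₀, b₀, hb₀, hab₀⟩ : ∃ a ∈ V, ∃ b ∈ V, 2 * R - 4 * (ε * R) < dist a b := by
    by_contra hcon
    push Not at hcon
    exact absurd (diam_le_of_forall_dist_le (by linarith) hcon) (not_le.2 hdV)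
  have n1 : ∀ u ∈ C₁, ∀ v ∈ C₁, dist u v ≤ c₁ := fun u hu v hv =>
    dist_le_length h1c hu hv hc1n hc1'.le
  have n2 : ∀ u ∈ C₂, ∀ v ∈ C₂, dist u v ≤ c₂ := fun u hu v hv =>
    dist_le_length h2c hu hv hc2n hc2'.le
  obtain ⟨a, ha, b, hb, hab⟩ : ∃ a ∈ C₁, ∃ b ∈ C₂, 2 * R - 4 * (ε * R) < dist a b := by
    rcases ha₀ with ha | ha <;> rcases hb₀ with hb | hb
    · have := n1 _ ha _ hb; linarith
    · exact ⟨_, ha, _, hb, hab₀⟩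
    · exact ⟨_, hb, _, ha, by rwa [dist_comm]⟩
    · have := n2 _ ha _ hb; linarith
  have hab0 : 0 < dist a b := by linarith
  have hban : ‖b - a‖ = dist a b := by rw [dist_comm, dist_eq_norm]
  set e : E := (dist a b)⁻¹ • (b - a) with he
  have he1 : ‖e‖ = 1 := by
    rw [he, norm_smul, hban, norm_inv, Real.norm_of_nonneg hab0.le, inv_mul_cancel₀ hab0.ne']
  have hbe : ⟪b - x, e⟫ - ⟪a - x, e⟫ = dist a b := by
    rw [← inner_sub_left, sub_sub_sub_cancel_right, he, inner_smul_right, real_inner_self_eq_norm_sq,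
      hban]
    field_simp
  have ple : ∀ u, |⟪u - x, e⟫| ≤ dist u x := by
    intro u
    have := abs_real_inner_le_norm (u - x) e
    rwa [he1, mul_one, ← dist_eq_norm] at this
  have pa := abs_le.1 (ple a)
  have pb := abs_le.1 (ple b)
  have dax : dist a x ≤ R := h1R ha
  have dbx : dist b x ≤ R := h2R hb
  have qa : ⟪a - x, e⟫ ≤ - R + 4 * (ε * R) := by linarith
  have qb : R - 4 * (ε * R) ≤ ⟪b - x, e⟫ := by linarith
  have k1 : ∀ y ∈ C₁, ⟪y - x, e⟫ ≤ - dist y x + 12 * (ε * R) := by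
    intro y hy
    have h1 := perim h1c hx1 hy ha hc1n hc1'.le
    have h2 := inner_le_dist he1 (y - x) (a - x)
    rw [dist_sub_right] at h2
    rw [dist_comm x y] at h1
    linarith
  have k2 : ∀ y ∈ C₂, dist y x - 12 * (ε * R) ≤ ⟪y - x, e⟫ := by
    intro y hy
    have h1 := perim h2c hx2 hy hb hc2n hc2'.le
    have h2 := inner_le_dist he1 (b - x) (y - x)
    rw [dist_sub_right, dist_comm b y] at h2
    rw [dist_comm x y] at h1
    linarith
  refine ⟨e, he1, ?_, ?_, ?_⟩
  · intro w hw hwx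
    obtain ⟨y, hyV, hy⟩ : ∃ y ∈ V, dist w y < 3 * (ε * R) := by
      by_contra hcon
      push Not at hcon
      have hB := hd1 (closedBall x R) isClosed_closedBall (mem_closedBall_self hR.le)
        (lt_of_lt_of_le hVpos (diam_mono hVR isBounded_closedBall)) (diam_closedBall hR.le)
      have hB2 : μH[1] (S ∩ closedBall x R) ≤ ENNReal.ofReal ((1 + ε) * (2 * R)) := by
        refine hB.trans (ENNReal.ofReal_le_ofReal ?_)
        gcongr
        exact diam_closedBall hR.le
      have hw3 := ball_lower hS hw (h1S hx1) (x := w) (s := 0) (r := 3 * (ε * R)) (by simp)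
        (by rw [dist_comm]; exact hcon x (Or.inl hx1))
      rw [sub_zero] at hw3
      have hdis : Disjoint (S ∩ ball w (3 * (ε * R))) V := by
        rw [Set.disjoint_left]
        rintro y ⟨_, hyb⟩ hyV
        rw [mem_ball, dist_comm] at hyb
        exact absurd (hcon y hyV) (not_le.2 hyb)
      have hun : μH[1] (S ∩ ball w (3 * (ε * R))) + μH[1] V ≤ μH[1] (S ∩ closedBall x R) := by
        rw [← measure_union hdis hVcl.measurableSet]
        apply measure_mono
        apply Set.union_subset
        · rintro y ⟨hyS, hyb⟩
          refine ⟨hyS, ?_⟩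
          rw [mem_ball] at hyb
          have := dist_triangle y w x
          rw [mem_closedBall]
          linarith
        · exact Set.subset_inter hVS hVR
      have hfin := ((add_le_add hw3 hVeq.ge).trans hun).trans hB2
      rw [← ENNReal.ofReal_add (by positivity) (by positivity),
        ENNReal.ofReal_le_ofReal_iff (by positivity)] at hfin
      nlinarith
    have hyk : dist y x - 12 * (ε * R) ≤ |⟪y - x, e⟫| := by
      rcases hyV with hy1 | hy2
      · have := k1 y hy1
        have := neg_abs_le ⟪y - x, e⟫
        linarith
      · have := k2 y hy2
        have := le_abs_self ⟪y - x, e⟫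
        linarith
    have h1 := dist_triangle w y x
    have h2 : |⟪y - x, e⟫| - |⟪w - x, e⟫| ≤ dist w y := by
      refine (abs_sub_abs_le_abs_sub _ _).trans ?_
      rw [abs_le]
      have a1 := inner_le_dist he1 (y - x) (w - x)
      have a2 := inner_le_dist he1 (w - x) (y - x)
      rw [dist_sub_right] at a1 a2
      rw [dist_comm y w] at a1
      constructor <;> linarith
    linarith
  · intro ρ h0 h1
    obtain ⟨y, hy, hyρ⟩ := h1c.intermediate_value hx1 hp1 (f := fun w => dist w x) (by fun_prop)
      (show ρ ∈ Set.Icc _ _ from ⟨by simpa using h0, by simpa [hp1R] using h1⟩)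
    refine ⟨y, h1S hy, hyρ, ?_⟩
    have := k1 y hy
    simp only at hyρ
    rwa [hyρ] at this
  · intro ρ h0 h1
    obtain ⟨y, hy, hyρ⟩ := h2c.intermediate_value hx2 hp2 (f := fun w => dist w x) (by fun_prop)
      (show ρ ∈ Set.Icc _ _ from ⟨by simpa using h0, by simpa [hp2R] using h1⟩)
    refine ⟨y, h2S hy, hyρ, ?_⟩
    have := k2 y hy
    simp only at hyρ
    rwa [hyρ] at this

/-- a connected set close to `S` has almost full length in the ball -/
lemma local_length {S T : Set E} {x e : E} {R ε : ℝ} (hR : 0 < R) (hε : 0 < ε)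
    (hε1 : ε ≤ 1 / 100) (he : ‖e‖ = 1)
    (k0 : ∀ w ∈ S, dist w x ≤ R / 2 + ε * R → dist w x - 18 * (ε * R) ≤ |⟪w - x, e⟫|)
    (k1 : ∀ ρ, 0 ≤ ρ → ρ ≤ R → ∃ y ∈ S, dist y x = ρ ∧ ⟪y - x, e⟫ ≤ - ρ + 12 * (ε * R))
    (k2 : ∀ ρ, 0 ≤ ρ → ρ ≤ R → ∃ y ∈ S, dist y x = ρ ∧ ρ - 12 * (ε * R) ≤ ⟪y - x, e⟫)
    (hT : IsPreconnected T) (hST : ∀ y ∈ S, ∃ z ∈ T, dist y z < ε * R)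
    (hTS : ∀ z ∈ T, ∃ y ∈ S, dist y z < ε * R) :
    ENNReal.ofReal (R - 80 * (ε * R)) ≤ μH[1] (T ∩ closedBall x (R / 2)) := by
  have hεR : 0 < ε * R := mul_pos hε hR
  have hεR1 : ε * R ≤ R / 100 := by nlinarith
  set π : E → ℝ := fun y => ⟪y - x, e⟫ with hπ
  have hπc : Continuous π := by fun_prop
  have hπ1 : ∀ u v, |π u - π v| ≤ dist u v := by
    intro u v
    rw [abs_le]
    have a1 := inner_le_dist he (u - x) (v - x)
    have a2 := inner_le_dist he (v - x) (u - x)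
    rw [dist_sub_right] at a1 a2
    rw [dist_comm v u] at a2
    simp only [hπ]
    constructor <;> linarith
  have hπx : π x = 0 := by simp [hπ]
  have hπd : ∀ u, |π u| ≤ dist u x := fun u => by simpa [hπx] using hπ1 u x
  set h₀ := R / 2 - 25 * (ε * R) with hh₀
  set P := π '' (T ∩ closedBall x (R / 2)) with hP
  have hgap : ∀ h1 ∈ Set.Icc (-h₀) h₀ \ P, ∀ h2 ∈ Set.Icc (-h₀) h₀ \ P, h1 ≤ h2 →
      h2 - h1 ≤ 30 * (ε * R) := by
    rintro h1 ⟨⟨h1a, h1b⟩, h1P⟩ h2 ⟨⟨h2a, h2b⟩, h2P⟩ hle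
    by_contra hcon
    push Not at hcon
    obtain ⟨y, hyS, hyx, hya, hyb⟩ : ∃ y ∈ S, dist y x ≤ h₀ ∧ h1 + 2 * (ε * R) ≤ π y ∧
        π y ≤ h2 - 2 * (ε * R) := by
      rcases le_total ((h1 + h2) / 2) 0 with hm | hm
      · obtain ⟨y, hy, hyd, hyπ⟩ := k1 (-((h1 + h2) / 2)) (by linarith) (by linarith)
        have := abs_le.1 (hπd y)
        have hyπ' : π y ≤ _ := hyπ
        exact ⟨y, hy, by linarith, by linarith, by linarith⟩
      · obtain ⟨y, hy, hyd, hyπ⟩ := k2 ((h1 + h2) / 2) (by linarith) (by linarith)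
        have := abs_le.1 (hπd y)
        have hyπ' : _ ≤ π y := hyπ
        exact ⟨y, hy, by linarith, by linarith, by linarith⟩
    obtain ⟨z, hzT, hzy⟩ := hST y hyS
    have hz1 := abs_le.1 (hπ1 y z)
    have hzx : dist z x < R / 2 := by
      have := dist_triangle z y x
      rw [dist_comm z y] at this
      linarith
    set O : Set E := ball x (R / 2) ∩ (π ⁻¹' Set.Ioo h1 h2) with hO
    have hOo : IsOpen O := isOpen_ball.inter (isOpen_Ioo.preimage hπc)
    have hcl : closure O ∩ T ⊆ O := by
      rintro w ⟨hwO, hwT⟩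
      have hw1 : w ∈ closedBall x (R / 2) ∩ π ⁻¹' Set.Icc h1 h2 := by
        refine closure_minimal ?_ (isClosed_closedBall.inter (isClosed_Icc.preimage hπc)) hwO
        exact Set.inter_subset_inter ball_subset_closedBall (Set.preimage_mono Set.Ioo_subset_Icc_self)
      obtain ⟨hwb, hwπ⟩ := hw1
      have hwP : π w ∈ P := ⟨w, ⟨hwT, hwb⟩, rfl⟩
      have hlt1 : h1 < π w := lt_of_le_of_ne hwπ.1 (fun hh => h1P (hh ▸ hwP))
      have hlt2 : π w < h2 := lt_of_le_of_ne hwπ.2 (fun hh => h2P (hh ▸ hwP))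
      refine ⟨?_, hlt1, hlt2⟩
      rw [mem_closedBall] at hwb
      rcases hwb.lt_or_eq with hlt | heq
      · exact hlt
      · exfalso
        obtain ⟨v, hvS, hvw⟩ := hTS w hwT
        have t1 := dist_triangle v w x
        have t2 := dist_triangle w v x
        rw [dist_comm w v] at t2
        have hk : dist v x - 18 * (ε * R) ≤ |π v| := k0 v hvS (by linarith)
        have h3 : |π v| - |π w| ≤ dist v w := (abs_sub_abs_le_abs_sub _ _).trans (hπ1 v w)
        have h4 : |π w| ≤ h₀ := abs_le.2 ⟨by linarith, by linarith⟩
        linarith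
    have hsub := hT.subset_of_closure_inter_subset hOo ⟨z, hzT, hzx, by constructor <;> linarith⟩ hcl
    obtain ⟨q, hqS, hqx, -⟩ := k1 R hR.le le_rfl
    obtain ⟨q', hqT, hqq⟩ := hST q hqS
    have := (hsub hqT).1
    rw [mem_ball] at this
    have := dist_triangle q q' x
    linarith
  have hlip : LipschitzWith 1 π := LipschitzWith.of_dist_le_mul fun u v => by
    simpa [Real.dist_eq] using hπ1 u v
  have hm := hlip.hausdorffMeasure_image_le (d := 1) zero_le_one (T ∩ closedBall x (R / 2))
  simp only [ENNReal.coe_one, ENNReal.one_rpow, one_mul] at hm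
  rw [hausdorffMeasure_real] at hm
  refine le_trans ?_ hm
  have hM : volume (Set.Icc (-h₀) h₀ \ P) ≤ ENNReal.ofReal (30 * (ε * R)) := by
    refine (Real.volume_le_diam _).trans (ediam_le_of_forall_dist_le ?_)
    intro u hu v hv
    rw [Real.dist_eq]
    rcases le_total u v with huv | huv
    · rw [abs_sub_comm, abs_of_nonneg (by linarith)]
      exact hgap u hu v hv huv
    · rw [abs_of_nonneg (by linarith)]
      exact hgap v hv u hu huv
  have hI : ENNReal.ofReal (h₀ - -h₀) ≤ volume P + ENNReal.ofReal (30 * (ε * R)) := by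
    rw [← Real.volume_Icc]
    refine (measure_mono (fun u hu => ?_ : Set.Icc (-h₀) h₀ ⊆ P ∪ (Set.Icc (-h₀) h₀ \ P))).trans
      ((measure_union_le _ _).trans (by gcongr))
    by_cases h : u ∈ P
    · exact Or.inl h
    · exact Or.inr ⟨hu, h⟩
  have : R - 80 * (ε * R) = (h₀ - -h₀) - 30 * (ε * R) := by rw [hh₀]; ring
  rw [this, ENNReal.ofReal_sub _ (by positivity)]
  exact tsub_le_iff_right.2 hI

end local_est
end Golab

namespace Golab
open Metric
open scoped ENNReal

section arcs
variable {X : Type*} [MetricSpace X]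

/-- `z` is the end of a chain of `N` steps smaller than `ε` in `S`, starting at `x` -/
def IsChainTo (S : Set X) (ε : ℝ) (x z : X) (N : ℕ) : Prop :=
  ∃ c : ℕ → X, (∀ i, c i ∈ S) ∧ c 0 = x ∧ c N = z ∧ ∀ i < N, dist (c i) (c (i + 1)) < ε

lemma IsChainTo.snoc {S : Set X} {ε : ℝ} {x z w : X} {N : ℕ} (h : IsChainTo S ε x z N)
    (hw : w ∈ S) (hd : dist z w < ε) : IsChainTo S ε x w (N + 1) := by
  obtain ⟨c, hS, h0, hN, hc⟩ := h
  refine ⟨fun i => if i ≤ N then c i else w, ?_, ?_, ?_, ?_⟩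
  · intro i; dsimp only; split_ifs; exacts [hS i, hw]
  · simp [h0]
  · simp
  · intro i hi
    rcases Nat.lt_succ_iff_lt_or_eq.1 hi with hi | rfl
    · simp only [hi.le, Nat.succ_le_of_lt hi, if_true]
      exact hc i hi
    · simpa [hN] using hd

lemma exists_chain {S : Set X} (hS : IsPreconnected S) {x y : X} (hx : x ∈ S) (hy : y ∈ S) {ε : ℝ}
    (hε : 0 < ε) : ∃ N, IsChainTo S ε x y N := by
  set O : Set X := ⋃ z ∈ {z | z ∈ S ∧ ∃ N, IsChainTo S ε x z N}, ball z (ε / 2) with hO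
  have hOo : IsOpen O := isOpen_biUnion fun _ _ => isOpen_ball
  have hxx : IsChainTo S ε x x 0 := ⟨fun _ => x, fun _ => hx, rfl, rfl, by simp⟩
  have hmem : ∀ w ∈ S, (∃ N, IsChainTo S ε x w N) → w ∈ O := fun w hw h =>
    Set.mem_biUnion (x := w) ⟨hw, h⟩ (mem_ball_self (by linarith))
  have hsub := hS.subset_of_closure_inter_subset hOo ⟨x, hx, hmem x hx ⟨0, hxx⟩⟩ (by
    rintro w ⟨hwO, hwS⟩
    obtain ⟨v, hv, hvw⟩ := Metric.mem_closure_iff.1 hwO (ε / 2) (by linarith)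
    obtain ⟨z, ⟨hzS, N, hz⟩, hzv⟩ := Set.mem_iUnion₂.1 hv
    refine hmem w hwS ⟨N + 1, hz.snoc hwS ?_⟩
    rw [mem_ball] at hzv
    have := dist_triangle z v w
    rw [dist_comm z v, dist_comm v w] at this
    linarith)
  obtain ⟨z, ⟨hzS, N, hz⟩, hzv⟩ := Set.mem_iUnion₂.1 (hsub hy)
  rw [mem_ball, dist_comm] at hzv
  exact ⟨N + 1, hz.snoc hy (by linarith)⟩

lemma exists_short_chain [MeasurableSpace X] [BorelSpace X] {S : Set X} (hS : IsPreconnected S)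
    {x y : X} (hx : x ∈ S) (hy : y ∈ S) {H : ℝ} (hH0 : 0 ≤ H) (hH : μH[1] S ≤ ENNReal.ofReal H)
    {ε : ℝ} (hε : 0 < ε) (hεxy : ε ≤ dist x y) :
    ∃ N : ℕ, N * ε ≤ 4 * H ∧ IsChainTo S ε x y N := by
  classical
  have hex := exists_chain hS hx hy hε
  set N := Nat.find hex with hN
  have hmin : ∀ m, IsChainTo S ε x y m → N ≤ m := fun m hm => Nat.find_min' hex hm
  have hch : IsChainTo S ε x y N := Nat.find_spec hex
  refine ⟨N, ?_, hch⟩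
  obtain ⟨c, hcS, hc0, hcN, hc⟩ := hch
  have hsep : ∀ i j, i + 2 ≤ j → j ≤ N → ε ≤ dist (c i) (c j) := by
    intro i j hij hjN
    by_contra hcon
    push Not at hcon
    have := hmin (N - (j - i - 1)) ⟨fun k => if k ≤ i then c k else c (k + (j - i - 1)), ?_, ?_, ?_, ?_⟩
    · omega
    · intro k; dsimp only; split_ifs; exacts [hcS _, hcS _]
    · simp [hc0]
    · have h1 : ¬ (N - (j - i - 1) ≤ i) := by omega
      have h2 : N - (j - i - 1) + (j - i - 1) = N := by omega
      simp only [h1, if_false, h2, hcN]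
    · intro k hk
      rcases lt_trichotomy k i with h | h | h
      · simp only [h.le, Nat.succ_le_of_lt h, if_true]
        exact hc k (by omega)
      · subst h
        have h2 : k + 1 + (j - k - 1) = j := by omega
        simpa [h2] using hcon
      · have h1 : ¬ k ≤ i := by omega
        have h2 : ¬ k + 1 ≤ i := by omega
        have h3 : k + 1 + (j - i - 1) = k + (j - i - 1) + 1 := by omega
        simp only [h1, h2, if_false, h3]
        exact hc _ (by omega)
  have hball : ∀ i, ENNReal.ofReal (ε / 2) ≤ μH[1].restrict S (ball (c i) (ε / 2)) := by
    intro i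
    rw [Measure.restrict_apply measurableSet_ball, Set.inter_comm]
    rcases le_total (ε / 2) (dist x (c i)) with h | h
    · simpa using ball_lower hS (hcS i) hx (x := c i) (s := 0) (by simp) h
    · refine le_trans ?_ (ball_lower hS (hcS i) hy (x := c i) (s := 0) (r := ε / 2) (by simp) ?_)
      · simp
      · have := dist_triangle x (c i) y
        rw [dist_comm y]
        linarith
  have hdisj : Set.PairwiseDisjoint (↑(Finset.range (N / 2 + 1)) : Set ℕ)
      (fun i => ball (c (2 * i)) (ε / 2)) := by
    have aux : ∀ i j, i < j → j < N / 2 + 1 →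
        Disjoint (ball (c (2 * i)) (ε / 2)) (ball (c (2 * j)) (ε / 2)) := by
      intro i j hij hj
      apply ball_disjoint_ball
      have := hsep (2 * i) (2 * j) (by omega) (by omega)
      linarith
    intro i hi j hj hij
    simp only [Finset.coe_range, Set.mem_Iio] at hi hj
    rcases lt_or_gt_of_ne hij with h | h
    · exact aux i j h hj
    · exact (aux j i h hi).symm
  have hsum : (∑ i ∈ Finset.range (N / 2 + 1), ENNReal.ofReal (ε / 2)) ≤ ENNReal.ofReal H := by
    calc _ ≤ ∑ i ∈ Finset.range (N / 2 + 1), μH[1].restrict S (ball (c (2 * i)) (ε / 2)) :=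
          Finset.sum_le_sum fun i _ => hball _
      _ = μH[1].restrict S (⋃ i ∈ Finset.range (N / 2 + 1), ball (c (2 * i)) (ε / 2)) :=
          (measure_biUnion_finset hdisj fun _ _ => measurableSet_ball).symm
      _ ≤ μH[1].restrict S Set.univ := measure_mono (Set.subset_univ _)
      _ ≤ _ := by rwa [Measure.restrict_apply_univ]
  rw [← ENNReal.ofReal_sum_of_nonneg (fun _ _ => by linarith), ENNReal.ofReal_le_ofReal_iff hH0] at hsum
  simp only [Finset.sum_const, Finset.card_range, nsmul_eq_mul] at hsum
  have hNN : (N : ℝ) ≤ 2 * ((N / 2 + 1 : ℕ) : ℝ) := by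
    exact_mod_cast (by omega : N ≤ 2 * (N / 2 + 1))
  nlinarith

lemma path_limit {S : Set X} (hS : IsCompact S) {x y : X} {f : ℕ → ℝ → X} {ε ℓ' : ℕ → ℝ} {ℓ : ℝ}
    (hfS : ∀ k s, f k s ∈ S) (hf : ∀ k s t, dist (f k s) (f k t) ≤ |s - t| + ε k)
    (h0 : ∀ k, f k 0 = x) (hℓ : ∀ k, f k (ℓ' k) = y) (hε : Tendsto ε atTop (𝓝 0))
    (hlim : Tendsto ℓ' atTop (𝓝 ℓ)) :
    ∃ g : ℝ → X, LipschitzWith 1 g ∧ (∀ s, g s ∈ S) ∧ g 0 = x ∧ g ℓ = y := by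
  let U : Ultrafilter ℕ := hyperfilter ℕ
  have hU : (U : Filter ℕ) ≤ atTop := Nat.hyperfilter_le_atTop
  have hex : ∀ s : ℝ, ∃ z ∈ S, Tendsto (fun k => f k s) U (𝓝 z) := by
    intro s
    obtain ⟨z, hz, hzl⟩ := hS.ultrafilter_le_nhds (U.map (fun k => f k s)) (by
      rw [le_principal_iff]
      exact Filter.Eventually.of_forall (f := (U : Filter ℕ)) (fun k => hfS k s))
    exact ⟨z, hz, hzl⟩
  choose g hgS hg using hex
  refine ⟨g, ?_, hgS, ?_, ?_⟩
  · apply LipschitzWith.of_dist_le_mul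
    intro s t
    have h1 : Tendsto (fun k => |s - t| + ε k) U (𝓝 (|s - t| + 0)) :=
      tendsto_const_nhds.add (hε.mono_left hU)
    rw [add_zero] at h1
    have := le_of_tendsto_of_tendsto ((hg s).dist (hg t)) h1 (Eventually.of_forall fun k => hf k s t)
    simpa [Real.dist_eq] using this
  · exact tendsto_nhds_unique (hg 0) (by simp [h0])
  · have h1 : Tendsto (fun k => |ℓ - ℓ' k| + ε k) U (𝓝 (|ℓ - ℓ| + 0)) :=
      ((tendsto_const_nhds.sub (hlim.mono_left hU)).abs).add (hε.mono_left hU)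
    rw [sub_self, abs_zero, add_zero] at h1
    have h2 := (hg ℓ).dist (tendsto_const_nhds (x := y) (f := (U : Filter ℕ)))
    have := le_of_tendsto_of_tendsto h2 h1 (Eventually.of_forall fun k => by
      have := hf k ℓ (ℓ' k)
      rwa [hℓ k] at this)
    exact dist_le_zero.1 this

/-- existence of a Lipschitz path -/
lemma exists_path [MeasurableSpace X] [BorelSpace X] {S : Set X} (hSc : IsCompact S)
    (hS : IsPreconnected S) (hfin : μH[1] S ≠ ⊤) {x y : X} (hx : x ∈ S) (hy : y ∈ S) (hxy : x ≠ y) :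
    ∃ ℓ : ℝ, 0 ≤ ℓ ∧ ∃ g : ℝ → X, LipschitzWith 1 g ∧ (∀ s, g s ∈ S) ∧ g 0 = x ∧ g ℓ = y := by
  set H := (μH[1] S).toReal with hHdef
  have hH : μH[1] S ≤ ENNReal.ofReal H := by rw [hHdef, ENNReal.ofReal_toReal hfin]
  have hH0 : 0 ≤ H := ENNReal.toReal_nonneg
  have hd : 0 < dist x y := dist_pos.2 hxy
  let ε : ℕ → ℝ := fun k => dist x y * (1 / ((k : ℝ) + 1))
  have hεpos : ∀ k, 0 < ε k := fun k => by positivity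
  have hεle : ∀ k, ε k ≤ dist x y := fun k => by
    have : 1 / ((k : ℝ) + 1) ≤ 1 := by
      rw [div_le_one (by positivity)]
      have : (0 : ℝ) ≤ k := Nat.cast_nonneg k
      linarith
    calc ε k ≤ dist x y * 1 := mul_le_mul_of_nonneg_left this hd.le
      _ = _ := mul_one _
  have hεlim : Tendsto ε atTop (𝓝 0) := by
    have h := (tendsto_one_div_add_atTop_nhds_zero_nat (𝕜 := ℝ)).const_mul (dist x y)
    rw [mul_zero] at h
    exact h
  choose N hN c hcS hc0 hcN hc using fun k => exists_short_chain hS hx hy hH0 hH (hεpos k) (hεle k)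
  have hcd : ∀ k i j, i ≤ j → j ≤ N k → dist (c k i) (c k j) ≤ (j - i : ℝ) * ε k := by
    intro k i j hij
    induction j, hij using Nat.le_induction with
    | base => intro _; simp
    | succ j hj ih =>
      intro hjN
      have h1 := ih (by omega)
      have h2 := hc k j (by omega)
      have := dist_triangle (c k i) (c k j) (c k (j + 1))
      push_cast
      linarith
  let f : ℕ → ℝ → X := fun k s => c k (min ⌊s / ε k⌋₊ (N k))
  have hfl : ∀ k s t, s ≤ t → dist (f k s) (f k t) ≤ |s - t| + ε k := by
    intro k s t hst
    have hm : ⌊s / ε k⌋₊ ≤ ⌊t / ε k⌋₊ := Nat.floor_mono (div_le_div_of_nonneg_right hst (hεpos k).le)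
    refine (hcd k _ _ (min_le_min_right _ hm) (min_le_right _ _)).trans ?_
    have h1 : ((min ⌊t / ε k⌋₊ (N k) : ℕ) : ℝ) - ((min ⌊s / ε k⌋₊ (N k) : ℕ) : ℝ) ≤
        (⌊t / ε k⌋₊ : ℝ) - ⌊s / ε k⌋₊ := by
      have : min ⌊t / ε k⌋₊ (N k) + ⌊s / ε k⌋₊ ≤ ⌊t / ε k⌋₊ + min ⌊s / ε k⌋₊ (N k) := by omega
      have : ((min ⌊t / ε k⌋₊ (N k) : ℕ) : ℝ) + ⌊s / ε k⌋₊ ≤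
        ⌊t / ε k⌋₊ + ((min ⌊s / ε k⌋₊ (N k) : ℕ) : ℝ) := by exact_mod_cast this
      linarith
    have h2 : (⌊t / ε k⌋₊ : ℝ) - ⌊s / ε k⌋₊ ≤ (t - s) / ε k + 1 := by
      have h3 := Nat.lt_floor_add_one (s / ε k)
      rcases le_total 0 (t / ε k) with ht | ht
      · have := Nat.floor_le ht
        rw [sub_div]
        linarith
      · rw [Nat.floor_of_nonpos ht]
        have : 0 ≤ (t - s) / ε k := div_nonneg (by linarith) (hεpos k).le
        have : (0 : ℝ) ≤ ⌊s / ε k⌋₊ := Nat.cast_nonneg _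
        push_cast
        linarith
    calc _ ≤ ((t - s) / ε k + 1) * ε k := mul_le_mul_of_nonneg_right (h1.trans h2) (hεpos k).le
      _ = (t - s) + ε k := by
        have := (hεpos k).ne'
        field_simp
      _ = _ := by rw [abs_sub_comm, abs_of_nonneg (by linarith)]
  refine ⟨4 * H, by positivity, path_limit hSc (f := f) (ε := ε) (ℓ' := fun _ => 4 * H)
    (fun k s => hcS k _) ?_ ?_ ?_ hεlim tendsto_const_nhds⟩
  · intro k s t
    rcases le_total s t with h | h
    · exact hfl k s t h
    · rw [dist_comm, abs_sub_comm]; exact hfl k t s h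
  · intro k; simp [f, hc0]
  · intro k
    have : N k ≤ ⌊4 * H / ε k⌋₊ := by
      apply Nat.le_floor
      rw [le_div_iff₀ (hεpos k)]
      exact hN k
    simp only [f, min_eq_right this, hcN]

lemma exists_arc [MeasurableSpace X] [BorelSpace X] {S : Set X} (hSc : IsCompact S)
    (hS : IsPreconnected S) (hfin : μH[1] S ≠ ⊤) {x y : X} (hx : x ∈ S) (hy : y ∈ S) :
    ∃ ℓ : ℝ, 0 ≤ ℓ ∧ ∃ g : ℝ → X, LipschitzWith 1 g ∧ (∀ s, g s ∈ S) ∧ g 0 = x ∧ g ℓ = y ∧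
      Set.InjOn g (Set.Icc 0 ℓ) := by
  rcases eq_or_ne x y with rfl | hxy
  · exact ⟨0, le_rfl, fun _ => x, LipschitzWith.const' x, fun _ => hx, rfl, rfl, by simp⟩
  let Λ : Set ℝ := {ℓ | 0 ≤ ℓ ∧ ∃ g : ℝ → X, LipschitzWith 1 g ∧ (∀ s, g s ∈ S) ∧ g 0 = x ∧ g ℓ = y}
  have hne : Λ.Nonempty := exists_path hSc hS hfin hx hy hxy
  have hbdd : BddBelow Λ := ⟨0, fun ℓ h => h.1⟩
  obtain ⟨ℓ', -, hlim, hmem⟩ := exists_seq_tendsto_sInf hne hbdd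
  choose h0 f hf hfS hf0 hfℓ using hmem
  obtain ⟨g, hg, hgS, hg0, hgℓ⟩ := path_limit hSc (ε := fun _ => 0) hfS
    (fun k s t => by simpa [Real.dist_eq] using (hf k).dist_le_mul s t) hf0 hfℓ tendsto_const_nhds hlim
  set ℓ := sInf Λ with hℓ
  have hℓ0 : 0 ≤ ℓ := le_csInf hne fun b hb => hb.1
  refine ⟨ℓ, hℓ0, g, hg, hgS, hg0, hgℓ, ?_⟩
  have hgd : ∀ s t, dist (g s) (g t) ≤ |s - t| := fun s t => by
    simpa [Real.dist_eq] using hg.dist_le_mul s t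
  have key : ∀ s t, 0 ≤ s → s < t → t ≤ ℓ → g s ≠ g t := by
    intro s t hs hst ht heq
    have hΛ : ℓ - (t - s) ∈ Λ := by
      refine ⟨by linarith, fun u => if u ≤ s then g u else g (u + (t - s)), ?_, ?_, ?_, ?_⟩
      · have aux : ∀ u v, u ≤ v → dist ((fun u => if u ≤ s then g u else g (u + (t - s))) u)
            ((fun u => if u ≤ s then g u else g (u + (t - s))) v) ≤ |u - v| := by
          intro u v huv
          dsimp only
          rcases le_or_gt u s with hu | hu <;> rcases le_or_gt v s with hv | hv
          · simp only [hu, hv, if_true]; exact hgd _ _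
          · simp only [hu, hv.not_ge, if_true, if_false]
            have h1 := hgd u s
            have h2 := hgd t (v + (t - s))
            have h3 := dist_triangle (g u) (g s) (g (v + (t - s)))
            rw [← heq] at h2
            rw [abs_sub_comm, abs_of_nonneg (by linarith)] at h1 h2 ⊢
            linarith
          · exact absurd (huv.trans hv) hu.not_ge
          · simp only [hu.not_ge, hv.not_ge, if_false]
            refine (hgd _ _).trans ?_
            rw [add_sub_add_right_eq_sub]
        apply LipschitzWith.of_dist_le_mul
        intro u v
        rw [NNReal.coe_one, one_mul, Real.dist_eq]
        rcases le_total u v with h | h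
        · exact aux u v h
        · rw [dist_comm, abs_sub_comm]; exact aux v u h
      · intro u; dsimp only; split_ifs; exacts [hgS _, hgS _]
      · simp [hs, hg0]
      · dsimp only
        split_ifs with h
        · have h1 : t = ℓ := by linarith
          have h2 : ℓ - (t - s) = s := by linarith
          rw [h2, heq, h1, hgℓ]
        · rw [sub_add_cancel, hgℓ]
    have := csInf_le hbdd hΛ
    linarith
  intro s hs t ht heq
  rcases lt_trichotomy s t with h | h | h
  · exact absurd heq (key s t hs.1 h ht.2)
  · exact h
  · exact absurd heq.symm (key t s ht.1 h hs.2)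

/-- first exit from a ball -/
lemma first_exit {h : ℝ → X} (hc : Continuous h) {T R : ℝ} (hT : 0 ≤ T) (hR : 0 < R)
    (hTR : R ≤ dist (h T) (h 0)) :
    ∃ t, 0 ≤ t ∧ t ≤ T ∧ dist (h t) (h 0) = R ∧ ∀ v, 0 ≤ v → v ≤ t → dist (h v) (h 0) ≤ R := by
  have hcd : Continuous fun v => dist (h v) (h 0) := by fun_prop
  have hivt : ∀ v, 0 ≤ v → R ≤ dist (h v) (h 0) → ∃ w, 0 ≤ w ∧ w ≤ v ∧ dist (h w) (h 0) = R := by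
    intro v hv hvR
    obtain ⟨w, hw, hwR⟩ := intermediate_value_Icc hv hcd.continuousOn
      (show R ∈ Set.Icc _ _ from ⟨by simpa using hR.le, hvR⟩)
    exact ⟨w, hw.1, hw.2, hwR⟩
  set Z : Set ℝ := Set.Icc 0 T ∩ {v | dist (h v) (h 0) = R} with hZ
  have hZc : IsCompact Z := isCompact_Icc.inter_right (isClosed_eq hcd continuous_const)
  obtain ⟨w, hw0, hwT, hwR⟩ := hivt T hT hTR
  obtain ⟨t, ht, hmin⟩ := hZc.exists_isLeast ⟨w, ⟨hw0, hwT⟩, hwR⟩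
  refine ⟨t, ht.1.1, ht.1.2, ht.2, fun v hv hvt => ?_⟩
  by_contra hcon
  push Not at hcon
  obtain ⟨w, hw0, hwv, hwR⟩ := hivt v hv hcon.le
  have h1 : t ≤ w := hmin ⟨⟨hw0, by linarith [ht.1.2]⟩, hwR⟩
  have h2 : v = w := by linarith
  rw [h2, hwR] at hcon
  exact lt_irrefl _ hcon

/-- the two-sided arc property -/
def TwoSided (S : Set X) (x : X) : Prop :=
  ∃ R₀ > 0, ∀ R, 0 < R → R ≤ R₀ → ∃ C₁ C₂ : Set X, ∃ p₁ ∈ C₁, ∃ p₂ ∈ C₂,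
    C₁ ⊆ S ∧ C₂ ⊆ S ∧ C₁ ⊆ closedBall x R ∧ C₂ ⊆ closedBall x R ∧ IsPreconnected C₁ ∧
    IsPreconnected C₂ ∧ IsClosed C₁ ∧ IsClosed C₂ ∧ x ∈ C₁ ∧ x ∈ C₂ ∧ C₁ ∩ C₂ ⊆ {x} ∧
    dist p₁ x = R ∧ dist p₂ x = R

lemma twoSided_of_arc {S : Set X} {g : ℝ → X} {ℓ u : ℝ} (hg : LipschitzWith 1 g)
    (hgS : ∀ s, g s ∈ S) (hinj : Set.InjOn g (Set.Icc 0 ℓ)) (hu0 : 0 < u) (huℓ : u < ℓ) :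
    TwoSided S (g u) := by
  have d1 : 0 < dist (g 0) (g u) := dist_pos.2 fun h =>
    hu0.ne (hinj ⟨le_rfl, by linarith⟩ ⟨hu0.le, huℓ.le⟩ h)
  have d2 : 0 < dist (g ℓ) (g u) := dist_pos.2 fun h =>
    huℓ.ne' (hinj ⟨by linarith, le_rfl⟩ ⟨hu0.le, huℓ.le⟩ h)
  refine ⟨min (dist (g 0) (g u)) (dist (g ℓ) (g u)), lt_min d1 d2, fun R hR hRle => ?_⟩
  have hgc := hg.continuous
  obtain ⟨t₁, a1, a2, a3, a4⟩ := first_exit (h := fun v => g (u - v)) (by fun_prop) hu0.le hR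
    (by simpa using hRle.trans (min_le_left _ _))
  obtain ⟨t₂, b1, b2, b3, b4⟩ := first_exit (h := fun v => g (u + v)) (T := ℓ - u) (by fun_prop)
    (by linarith) hR (by simpa using hRle.trans (min_le_right _ _))
  simp only [sub_zero, add_zero] at a3 a4 b3 b4
  refine ⟨g '' Set.Icc (u - t₁) u, g '' Set.Icc u (u + t₂), g (u - t₁), ⟨_, ⟨le_rfl, by linarith⟩, rfl⟩,
    g (u + t₂), ⟨_, ⟨by linarith, le_rfl⟩, rfl⟩, ?_, ?_, ?_, ?_, ?_, ?_, ?_, ?_, ?_, ?_, ?_, a3, b3⟩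
  · rintro _ ⟨v, -, rfl⟩; exact hgS v
  · rintro _ ⟨v, -, rfl⟩; exact hgS v
  · rintro _ ⟨v, hv, rfl⟩
    have := a4 (u - v) (by linarith [hv.2]) (by linarith [hv.1])
    rwa [sub_sub_cancel] at this
  · rintro _ ⟨v, hv, rfl⟩
    have := b4 (v - u) (by linarith [hv.1]) (by linarith [hv.2])
    rwa [add_sub_cancel] at this
  · exact isPreconnected_Icc.image _ hgc.continuousOn
  · exact isPreconnected_Icc.image _ hgc.continuousOn
  · exact (isCompact_Icc.image hgc).isClosed
  · exact (isCompact_Icc.image hgc).isClosed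
  · exact ⟨u, ⟨by linarith, le_rfl⟩, rfl⟩
  · exact ⟨u, ⟨le_rfl, by linarith⟩, rfl⟩
  · rintro _ ⟨⟨v, hv, rfl⟩, ⟨w, hw, hwv⟩⟩
    have := hinj (show w ∈ Set.Icc 0 ℓ from ⟨by linarith [hw.1], by linarith [hw.2]⟩)
      (show v ∈ Set.Icc 0 ℓ from ⟨by linarith [hv.1], by linarith [hv.2]⟩) hwv
    have : v = u := by linarith [hv.2, hw.1]
    simp [this]

lemma ae_twoSided [MeasurableSpace X] [BorelSpace X] {S : Set X} (hSc : IsCompact S)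
    (hS : IsPreconnected S) (hfin : μH[1] S ≠ ⊤) (hnt : S.Nontrivial) :
    ∃ N : Set X, μH[1] N = 0 ∧ ∀ x ∈ S, x ∉ N → TwoSided S x := by
  have hna : NullSingletonClass (μH[1] : Measure X) := Measure.nullSingletonClass_hausdorff X one_pos
  obtain ⟨p, hp⟩ := hnt.nonempty
  obtain ⟨D, hDS, hDc, hDd⟩ := hSc.isSeparable.exists_countable_dense_subset
  choose ℓ hℓ0 g hg hgS hg0 hgℓ hinj using fun q : S => exists_arc hSc hS hfin hp q.2
  let D' : Set S := {q | (q : X) ∈ D}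
  have hD'c : D'.Countable := hDc.preimage Subtype.val_injective
  set T : Set X := ⋃ q ∈ D', g q '' Set.Icc 0 (ℓ q) with hT
  have hTS : T ⊆ S := by
    refine Set.iUnion₂_subset fun q _ => ?_
    rintro _ ⟨v, -, rfl⟩
    exact hgS q v
  have hTm : MeasurableSet T := MeasurableSet.biUnion hD'c fun q _ =>
    (isCompact_Icc.image (hg q).continuous).isClosed.measurableSet
  have hDT : D ⊆ T := fun q hq =>
    Set.mem_biUnion (x := (⟨q, hDS hq⟩ : S)) hq ⟨ℓ ⟨q, hDS hq⟩, ⟨hℓ0 _, le_rfl⟩, hgℓ _⟩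
  have hTc : IsPreconnected T := by
    have : T = ⋃₀ ((fun q => g q '' Set.Icc 0 (ℓ q)) '' D') := by
      rw [Set.sUnion_image]
    rw [this]
    apply isPreconnected_sUnion p
    · rintro _ ⟨q, -, rfl⟩
      exact ⟨0, ⟨le_rfl, hℓ0 q⟩, hg0 q⟩
    · rintro _ ⟨q, -, rfl⟩
      exact isPreconnected_Icc.image _ (hg q).continuous.continuousOn
  have : IsFiniteMeasure (μH[1].restrict T : Measure X) :=
    ⟨by simpa using lt_of_le_of_lt (measure_mono hTS) hfin.lt_top⟩
  have hSc' : S ⊆ closure T := hDd.trans (closure_mono hDT)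
  have hnull : μH[1] (S \ T) = 0 := by
    have h1 := density_lower (μH[1].restrict T) (E := S \ T) (θ := 1 / 4) (by norm_num) (by
      rintro x ⟨hx, -⟩ δ hδ
      obtain ⟨z, hz, hzx⟩ := hnt.exists_ne x
      have hdz : 0 < dist z x := dist_pos.2 hzx
      obtain ⟨z', hz'T, hz'⟩ := Metric.mem_closure_iff.1 (hSc' hz) (dist z x / 2) (by linarith)
      have hz'x : dist z x / 2 ≤ dist z' x := by
        have := dist_triangle z z' x
        linarith
      set r := min (dist z x / 2) (δ / 3) with hr
      have hr0 : 0 < r := lt_min (by linarith) (by linarith)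
      obtain ⟨y, hyT, hy⟩ := Metric.mem_closure_iff.1 (hSc' hx) (r / 2) (by linarith)
      have hdpos : 0 < diam (closedBall x r) := by
        obtain ⟨w, hw, hwr⟩ := hS.intermediate_value hx hz (f := fun w => dist w x) (by fun_prop)
          (show r ∈ Set.Icc _ _ from ⟨by simpa using hr0.le, by
            have := min_le_left (dist z x / 2) (δ / 3)
            linarith⟩)
        have h1 : w ∈ closedBall x r := by simpa using hwr.le
        have := dist_le_diam_of_mem isBounded_closedBall h1 (mem_closedBall_self hr0.le)
        simp only at hwr
        linarith
      have hdle : diam (closedBall x r) ≤ 2 * r := diam_closedBall hr0.le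
      refine ⟨closedBall x r, isClosed_closedBall, mem_closedBall_self hr0.le, hdpos, ?_, ?_⟩
      · have := min_le_right (dist z x / 2) (δ / 3)
        linarith
      · rw [Measure.restrict_apply isClosed_closedBall.measurableSet, Set.inter_comm]
        have h3 := ball_lower hTc hyT hz'T (x := x) (s := r / 2) (r := r)
          (by rw [dist_comm]; exact hy.le) ((min_le_left _ _).trans hz'x)
        refine le_trans (ENNReal.ofReal_le_ofReal ?_) (h3.trans
          (measure_mono (Set.inter_subset_inter_right _ ball_subset_closedBall)))
        linarith)
    have h2 : μH[1].restrict T (S \ T) = 0 := by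
      rw [Measure.restrict_apply' hTm]
      simp
    rw [h2] at h1
    have h3 := le_antisymm h1 zero_le
    rcases mul_eq_zero.1 h3 with h | h
    · norm_num at h
    · exact h
  refine ⟨(S \ T) ∪ (D ∪ {p}), ?_, ?_⟩
  · refine measure_union_null hnull (measure_union_null (hDc.measure_zero _) (measure_singleton _))
  · intro x hx hxN
    simp only [Set.mem_union, Set.mem_sdiff, Set.mem_singleton_iff, not_or, not_and, not_not] at hxN
    obtain ⟨hxT, hxD, hxp⟩ := hxN
    obtain ⟨q, hq, u, hu, rfl⟩ := Set.mem_iUnion₂.1 (hxT hx)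
    apply twoSided_of_arc (hg q) (hgS q) (hinj q)
    · refine lt_of_le_of_ne hu.1 ?_
      rintro rfl
      exact hxp (hg0 q)
    · refine lt_of_le_of_ne hu.2 ?_
      rintro rfl
      rw [hgℓ q] at hxD
      exact hxD hq

end arcs
end Golab
namespace Golab
open Metric
open scoped ENNReal

section final
variable {X : Type*} [MetricSpace X] [MeasurableSpace X] [BorelSpace X]

lemma weak_ball {S : ℕ → Set X} {μ : Measure X} [IsFiniteMeasure μ]
    (hfin : ∀ n, μH[1] (S n) ≠ ⊤)
    (hweak : ∀ f : X → ℝ, Continuous f →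
      Tendsto (fun n => ∫ x, f x ∂((μH[1] : Measure X).restrict (S n))) atTop (𝓝 (∫ x, f x ∂μ)))
    {x : X} {c r r' : ℝ} (hrr : r < r')
    (h : ∀ᶠ n in atTop, ENNReal.ofReal c ≤ μH[1] (S n ∩ closedBall x r)) :
    ENNReal.ofReal c ≤ μ (closedBall x r') := by
  set f : X → ℝ := fun y => max 0 (min 1 ((r' - dist y x) / (r' - r))) with hf
  have hfc : Continuous f := by
    have : Continuous fun y => (r' - dist y x) / (r' - r) := by fun_prop
    exact continuous_const.max (continuous_const.min this)
  have hpos : 0 < r' - r := sub_pos.2 hrr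
  have hf0 : ∀ y, 0 ≤ f y := fun y => le_max_left _ _
  have hf1 : ∀ y, f y ≤ 1 := fun y => max_le zero_le_one (min_le_left _ _)
  have hint : ∀ (ν : Measure X) [IsFiniteMeasure ν], Integrable f ν := fun ν _ =>
    Integrable.of_bound hfc.measurable.aestronglyMeasurable 1
      (Eventually.of_forall fun y => by rw [Real.norm_eq_abs, abs_of_nonneg (hf0 y)]; exact hf1 y)
  have hlow : ∀ y, (closedBall x r).indicator (fun _ => (1 : ℝ)) y ≤ f y := by
    intro y
    by_cases hy : y ∈ closedBall x r
    · rw [Set.indicator_of_mem hy]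
      refine le_max_of_le_right (le_min le_rfl ?_)
      rw [le_div_iff₀ hpos]
      have : dist y x ≤ r := hy
      linarith
    · rw [Set.indicator_of_notMem hy]; exact hf0 y
  have hup : ∀ y, f y ≤ (closedBall x r').indicator (fun _ => (1 : ℝ)) y := by
    intro y
    by_cases hy : y ∈ closedBall x r'
    · rw [Set.indicator_of_mem hy]; exact hf1 y
    · rw [Set.indicator_of_notMem hy]
      have hy' : r' < dist y x := by simpa using hy
      refine max_le le_rfl ((min_le_right _ _).trans ?_)
      exact div_nonpos_of_nonpos_of_nonneg (by linarith) hpos.le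
  have hmB : ∀ s, MeasurableSet (closedBall x s) := fun s => isClosed_closedBall.measurableSet
  have hc : c ≤ ∫ y, f y ∂μ := by
    refine ge_of_tendsto (hweak f hfc) ?_
    filter_upwards [h] with n hn
    haveI : IsFiniteMeasure ((μH[1] : Measure X).restrict (S n)) :=
      ⟨by rw [Measure.restrict_apply_univ]; exact (hfin n).lt_top⟩
    have h1 : ∫ y, (closedBall x r).indicator (fun _ => (1 : ℝ)) y ∂((μH[1] : Measure X).restrict (S n))
        ≤ ∫ y, f y ∂((μH[1] : Measure X).restrict (S n)) :=
      integral_mono ((integrable_const 1).indicator (hmB r)) (hint _) hlow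
    rw [integral_indicator_const _ (hmB r), smul_eq_mul, mul_one] at h1
    refine le_trans ?_ h1
    rw [measureReal_def, Measure.restrict_apply (hmB r), Set.inter_comm]
    refine (ENNReal.ofReal_le_iff_le_toReal ?_).1 hn
    exact ne_top_of_le_ne_top (hfin n) (measure_mono Set.inter_subset_left)
  have h2 : ∫ y, f y ∂μ ≤ ∫ y, (closedBall x r').indicator (fun _ => (1 : ℝ)) y ∂μ :=
    integral_mono (hint _) ((integrable_const 1).indicator (hmB r')) hup
  rw [integral_indicator_const _ (hmB r'), smul_eq_mul, mul_one] at h2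
  exact (ENNReal.ofReal_le_iff_le_toReal (measure_ne_top _ _)).2 (hc.trans h2)

lemma weak_univ {S : ℕ → Set X} {μ : Measure X} [IsFiniteMeasure μ] {L : ℝ} (hL : 0 < L)
    (hlen : ∀ n, μH[1] (S n) ≤ ENNReal.ofReal L)
    (hweak : ∀ f : X → ℝ, Continuous f →
      Tendsto (fun n => ∫ x, f x ∂((μH[1] : Measure X).restrict (S n))) atTop (𝓝 (∫ x, f x ∂μ))) :
    μ Set.univ ≤ ENNReal.ofReal L := by
  have h := hweak (fun _ => 1) continuous_const
  simp only [integral_const, smul_eq_mul, mul_one] at h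
  have h2 : μ.real Set.univ ≤ L := by
    refine le_of_tendsto h (Eventually.of_forall fun n => ?_)
    rw [measureReal_def, Measure.restrict_apply_univ]
    exact ENNReal.toReal_le_of_le_ofReal hL.le (hlen n)
  rw [measureReal_def] at h2
  exact (ENNReal.le_ofReal_iff_toReal_le (measure_ne_top _ _) hL.le).2 h2

lemma limit_preconnected {S : ℕ → Set X} {S₀ : Set X} (hc : IsCompact S₀)
    (hS : ∀ n, IsPreconnected (S n))
    (hclose : ∀ τ > 0, ∀ᶠ n in atTop, (∀ y ∈ S₀, ∃ z ∈ S n, dist y z < τ) ∧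
      (∀ z ∈ S n, ∃ y ∈ S₀, dist y z < τ)) : IsPreconnected S₀ := by
  rw [isPreconnected_iff_subset_of_fully_disjoint_closed hc.isClosed]
  intro u v hu hv huv hd
  by_contra hcon
  push Not at hcon
  obtain ⟨h1, h2⟩ := hcon
  obtain ⟨a, ha, hau⟩ := Set.not_subset.1 h1
  obtain ⟨b, hb, hbv⟩ := Set.not_subset.1 h2
  have hav : a ∈ v := (huv ha).resolve_left hau
  have hbu : b ∈ u := (huv hb).resolve_right hbv
  have hd' : Disjoint (S₀ ∩ u) (S₀ ∩ v) := hd.mono Set.inter_subset_right Set.inter_subset_right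
  obtain ⟨δ, hδ, hdis⟩ := hd'.exists_thickenings (hc.inter_right hu) (hc.inter_right hv).isClosed
  obtain ⟨n, hn1, hn2⟩ := (hclose δ hδ).exists
  obtain ⟨z, hz, hza⟩ := hn1 a ha
  obtain ⟨w, hw, hwb⟩ := hn1 b hb
  have := hS n (thickening δ (S₀ ∩ u)) (thickening δ (S₀ ∩ v)) isOpen_thickening isOpen_thickening
    (by
      intro q hq
      obtain ⟨y, hy, hyq⟩ := hn2 q hq
      rw [dist_comm] at hyq
      rcases huv hy with h | h
      · exact Or.inl (mem_thickening_iff.2 ⟨y, ⟨hy, h⟩, hyq⟩)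
      · exact Or.inr (mem_thickening_iff.2 ⟨y, ⟨hy, h⟩, hyq⟩))
    ⟨w, hw, mem_thickening_iff.2 ⟨b, ⟨hb, hbu⟩, by rwa [dist_comm]⟩⟩
    ⟨z, hz, mem_thickening_iff.2 ⟨a, ⟨ha, hav⟩, by rwa [dist_comm]⟩⟩
  obtain ⟨q, -, hq1, hq2⟩ := this
  exact Set.disjoint_left.1 hdis hq1 hq2

end final

section final2
variable {E : Type*} [NormedAddCommGroup E] [InnerProductSpace ℝ E] [MeasurableSpace E]
  [BorelSpace E] [Nontrivial E]

lemma diam_cb (x : E) {r : ℝ} (hr : 0 < r) : 0 < diam (closedBall x r) ∧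
    diam (closedBall x r) ≤ 2 * r := by
  refine ⟨?_, diam_closedBall hr.le⟩
  obtain ⟨v, hv⟩ := exists_norm_eq E hr.le
  have := dist_le_diam_of_mem (isBounded_closedBall (x := x) (r := r))
    (show x + v ∈ closedBall x r by simp [hv]) (mem_closedBall_self hr.le)
  simp [hv] at this
  linarith

variable {S : ℕ → Set E} {S₀ : Set E} {μ : Measure E} [IsFiniteMeasure μ]

lemma finite_limit (hfin : ∀ n, μH[1] (S n) ≠ ⊤)
    (hweak : ∀ f : E → ℝ, Continuous f →
      Tendsto (fun n => ∫ x, f x ∂((μH[1] : Measure E).restrict (S n))) atTop (𝓝 (∫ x, f x ∂μ)))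
    (hS : ∀ n, IsPreconnected (S n)) (hnt : S₀.Nontrivial)
    (hclose : ∀ τ > 0, ∀ᶠ n in atTop, (∀ y ∈ S₀, ∃ z ∈ S n, dist y z < τ) ∧
      (∀ z ∈ S n, ∃ y ∈ S₀, dist y z < τ)) : μH[1] S₀ ≠ ⊤ := by
  have key : ENNReal.ofReal (1 / 8) * μH[1] S₀ ≤ μ S₀ := by
    refine density_lower μ (by norm_num) ?_
    intro x hx δ hδ
    obtain ⟨x', hx', hne⟩ := hnt.exists_ne x
    have hD : 0 < dist x' x := dist_pos.2 hne
    set D := dist x' x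
    set r := min (D / 2) (δ / 8) with hr
    have hr0 : 0 < r := lt_min (by linarith) (by linarith)
    have hrD : r ≤ D / 2 := min_le_left _ _
    have hrδ : r ≤ δ / 8 := min_le_right _ _
    obtain ⟨d1, d2⟩ := diam_cb x (r := 2 * r) (by linarith)
    refine ⟨closedBall x (2 * r), isClosed_closedBall, mem_closedBall_self (by linarith), d1,
      by linarith, ?_⟩
    refine (ENNReal.ofReal_le_ofReal (q := r - r / 4) (by linarith)).trans ?_
    refine weak_ball hfin hweak (r := r) (by linarith) ?_
    filter_upwards [hclose (r / 4) (by linarith)] with n hn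
    obtain ⟨y, hy, hyx⟩ := hn.1 x hx
    obtain ⟨z, hz, hzx⟩ := hn.1 x' hx'
    have h3 : D ≤ dist x' z + dist z x := dist_triangle _ _ _
    refine (ball_lower (hS n) hy hz (by rw [dist_comm]; exact hyx.le) (x := x) (r := r)
      (by linarith)).trans (measure_mono ?_)
    exact Set.inter_subset_inter_right _ ball_subset_closedBall
  intro htop
  rw [htop, ENNReal.mul_top (by simp)] at key
  exact measure_ne_top μ S₀ (top_le_iff.1 key)

lemma le_limit (hfin : ∀ n, μH[1] (S n) ≠ ⊤)
    (hweak : ∀ f : E → ℝ, Continuous f →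
      Tendsto (fun n => ∫ x, f x ∂((μH[1] : Measure E).restrict (S n))) atTop (𝓝 (∫ x, f x ∂μ)))
    (hS : ∀ n, IsPreconnected (S n)) (hnt : S₀.Nontrivial) (hSc : IsCompact S₀)
    (hclose : ∀ τ > 0, ∀ᶠ n in atTop, (∀ y ∈ S₀, ∃ z ∈ S n, dist y z < τ) ∧
      (∀ z ∈ S n, ∃ y ∈ S₀, dist y z < τ)) (A : Set E) : μH[1] (A ∩ S₀) ≤ μ (A ∩ S₀) := by
  have hS₀ := limit_preconnected hSc hS hclose
  have hS₀fin := finite_limit hfin hweak hS hnt hclose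
  obtain ⟨N₁, hN₁, h1⟩ := density_upper hS₀fin
  obtain ⟨N₂, hN₂, h2⟩ := ae_twoSided hSc hS₀ hS₀fin hnt
  have hN : μH[1] (N₁ ∪ N₂) = 0 := measure_union_null hN₁ hN₂
  have key : ∀ ε : ℝ, 0 < ε → ε ≤ 1 / 100 →
      ENNReal.ofReal (1 - 81 * ε) * μH[1] (A ∩ S₀) ≤ μ (A ∩ S₀) := by
    intro ε hε hε1
    have : ENNReal.ofReal (1 - 81 * ε) * μH[1] ((A ∩ S₀) \ (N₁ ∪ N₂)) ≤
        μ ((A ∩ S₀) \ (N₁ ∪ N₂)) := by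
      refine density_lower μ (by linarith) ?_
      rintro x ⟨⟨-, hx⟩, hxN⟩ δ hδ
      have hx1 : x ∉ N₁ := fun h => hxN (Or.inl h)
      have hx2 : x ∉ N₂ := fun h => hxN (Or.inr h)
      obtain ⟨δ', hδ', hd⟩ := h1 x hx hx1 ε hε
      obtain ⟨R₀, hR₀, ht⟩ := h2 x hx hx2
      set R := min R₀ (min (δ' / 3) (δ / 3)) with hRdef
      have hR : 0 < R := lt_min hR₀ (lt_min (by linarith) (by linarith))
      have hRδ' : R ≤ δ' / 3 := (min_le_right _ _).trans (min_le_left _ _)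
      have hRδ : R ≤ δ / 3 := (min_le_right _ _).trans (min_le_right _ _)
      obtain ⟨C₁, C₂, p₁, hp1, p₂, hp2, h1S, h2S, h1R, h2R, h1c, h2c, h1cl, h2cl, hxC1, hxC2,
        h12, hp1R, hp2R⟩ := ht R hR (min_le_left _ _)
      haveI := Measure.nullSingletonClass_hausdorff E one_pos
      have h12' : μH[1] (C₁ ∩ C₂) = 0 := measure_mono_null h12 (measure_singleton x)
      obtain ⟨e, he, k0, k1, k2⟩ := local_structure hR hε hε1 hS₀ h1S h2S h1R h2R h1c h2c h1cl h2cl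
        hxC1 hxC2 h12' hp1 hp2 hp1R hp2R
        (fun U hU hxU hU0 hUR => hd U hU hxU hU0 (by linarith))
      have hεR : 0 < ε * R := mul_pos hε hR
      have hεR1 : ε * R ≤ R / 100 := by nlinarith
      obtain ⟨d1, d2⟩ := diam_cb x (r := R / 2 + ε * R / 2) (by linarith)
      refine ⟨closedBall x (R / 2 + ε * R / 2), isClosed_closedBall,
        mem_closedBall_self (by linarith), d1, by linarith, ?_⟩
      refine (ENNReal.ofReal_le_ofReal (q := R - 80 * (ε * R)) ?_).trans ?_
      · have : (1 - 81 * ε) * diam (closedBall x (R / 2 + ε * R / 2)) ≤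
            (1 - 81 * ε) * (R + ε * R) :=
          mul_le_mul_of_nonneg_left (by linarith) (by linarith)
        nlinarith
      refine weak_ball hfin hweak (r := R / 2) (by linarith) ?_
      filter_upwards [hclose (ε * R) hεR] with n hn
      exact local_length hR hε hε1 he k0 k1 k2 (hS n) hn.1 hn.2
    rw [measure_sdiff_null hN] at this
    exact this.trans (measure_mono Set.sdiff_subset)
  have hlim : Tendsto (fun n : ℕ => ENNReal.ofReal (1 - 81 * ((1 / 100) * (1 / ((n : ℝ) + 1)))) *
      μH[1] (A ∩ S₀)) atTop (𝓝 (ENNReal.ofReal 1 * μH[1] (A ∩ S₀))) := by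
    refine ENNReal.Tendsto.mul_const ?_ (Or.inl (by simp))
    refine ENNReal.tendsto_ofReal ?_
    have h := (((tendsto_one_div_add_atTop_nhds_zero_nat (𝕜 := ℝ)).const_mul (1 / 100)).const_mul
      81).const_sub 1
    simpa only [mul_zero, sub_zero] using h
  rw [ENNReal.ofReal_one, one_mul] at hlim
  refine le_of_tendsto hlim (Eventually.of_forall fun n => key _ (by positivity) ?_)
  have : 1 / ((n : ℝ) + 1) ≤ 1 := by
    rw [div_le_one (by positivity)]
    linarith [n.cast_nonneg (α := ℝ)]
  linarith

end final2
end Golab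

/-- Compactness behind Proposition 2.6: if `S n ⊆ K` are closed connected sets
of `H¹`-length ≤ L converging in Hausdorff distance to a closed set `S₀`, and
`μ_n = H¹⌊S n` converges weakly* to `μ`, then `S₀` is connected,
`μ ≥ H¹⌊S₀`, and `H¹(S₀) ≤ L`. -/
theorem golab_compactness {K : Set (EuclideanSpace ℝ (Fin 2))} (hK : IsCompact K)
    (S : ℕ → Set (EuclideanSpace ℝ (Fin 2))) (S₀ : Set (EuclideanSpace ℝ (Fin 2)))
    (hScl : ∀ n, IsClosed (S n)) (hSconn : ∀ n, IsConnected (S n))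
    (hSK : ∀ n, S n ⊆ K) (hS₀K : S₀ ⊆ K) (hS₀cl : IsClosed S₀)
    (hS₀ne : S₀.Nonempty) {L : ℝ} (hL : 0 < L)
    (hlen : ∀ n, μH[1] (S n) ≤ ENNReal.ofReal L)
    (hconv : Tendsto (fun n => Metric.hausdorffDist (S n) S₀) atTop (𝓝 0))
    (μ : Measure (EuclideanSpace ℝ (Fin 2))) [IsFiniteMeasure μ]
    (hweak : ∀ f : EuclideanSpace ℝ (Fin 2) → ℝ, Continuous f →
      Tendsto (fun n => ∫ x, f x ∂(μH[1].restrict (S n))) atTop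
        (𝓝 (∫ x, f x ∂μ))) :
    IsConnected S₀ ∧ μH[1].restrict S₀ ≤ μ ∧ μH[1] S₀ ≤ ENNReal.ofReal L := by

  have hfin : ∀ n, μH[1] (S n) ≠ ⊤ := fun n => ne_top_of_le_ne_top ENNReal.ofReal_ne_top (hlen n)
  have hSc : IsCompact S₀ := hK.of_isClosed_subset hS₀cl hS₀K
  have hclose : ∀ τ > 0, ∀ᶠ n in atTop, (∀ y ∈ S₀, ∃ z ∈ S n, dist y z < τ) ∧
      (∀ z ∈ S n, ∃ y ∈ S₀, dist y z < τ) := by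
    intro τ hτ
    filter_upwards [hconv.eventually_lt_const hτ] with n hn
    have hne : Metric.hausdorffEDist (S n) S₀ ≠ ⊤ :=
      Metric.hausdorffEDist_ne_top_of_nonempty_of_bounded (hSconn n).nonempty hS₀ne
        (hK.isBounded.subset (hSK n)) hSc.isBounded
    constructor
    · intro y hy
      obtain ⟨z, hz, h⟩ := Metric.exists_dist_lt_of_hausdorffDist_lt' hy hn hne
      exact ⟨z, hz, by rw [dist_comm]; exact h⟩
    · intro z hz
      obtain ⟨y, hy, h⟩ := Metric.exists_dist_lt_of_hausdorffDist_lt hz hn hne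
      exact ⟨y, hy, by rw [dist_comm]; exact h⟩
  have hSp : ∀ n, IsPreconnected (S n) := fun n => (hSconn n).isPreconnected
  have hle : ∀ A, μH[1] (A ∩ S₀) ≤ μ (A ∩ S₀) := by
    intro A
    rcases S₀.subsingleton_or_nontrivial with hs | hnt
    · haveI := Measure.nullSingletonClass_hausdorff (EuclideanSpace ℝ (Fin 2)) one_pos
      have : μH[1] (A ∩ S₀) = 0 :=
        (hs.anti Set.inter_subset_right).measure_zero _
      rw [this]
      exact zero_le
    · exact Golab.le_limit hfin hweak hSp hnt hSc hclose A
  refine ⟨⟨hS₀ne, Golab.limit_preconnected hSc hSp hclose⟩, ?_, ?_⟩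
  · refine Measure.le_iff.2 fun A hA => ?_
    rw [Measure.restrict_apply hA]
    exact (hle A).trans (measure_mono Set.inter_subset_left)
  · have h := hle Set.univ
    rw [Set.univ_inter] at h
    exact h.trans ((measure_mono (Set.subset_univ _)).trans (Golab.weak_univ hL hlen hweak))
end

section
/- The Hausdorff measure H¹ is lower semicontinuous along Hausdorff-converging sequences of closed connected sets: if S_n ⊂ ℝ² are closed connected sets converging in the Hausdorff distance to S, then H¹(S) ≤ liminf_n H¹(S_n). -/
open MeasureTheory Filter Topology

/-- Rooted trees on finite subsets of `ι`, built by grafting. -/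
inductive GolabTree {ι : Type} [DecidableEq ι] (adj : ι → ι → Prop) : ι → Finset ι → Prop
  | single (r : ι) : GolabTree adj r {r}
  | graft {r s : ι} {A B : Finset ι} (hA : GolabTree adj r A) (hB : GolabTree adj s B)
      (h : adj r s) (hd : Disjoint A B) : GolabTree adj r (A ∪ B)

theorem GolabTree.add_leaf {ι : Type} [DecidableEq ι] {adj : ι → ι → Prop} {r : ι}
    {A : Finset ι} (hT : GolabTree adj r A) {v x : ι} (hv : v ∈ A) (hx : x ∉ A)
    (h : adj v x) : GolabTree adj r (A ∪ {x}) := by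
  induction hT with
  | single r =>
    rw [Finset.mem_singleton] at hv
    subst hv
    exact GolabTree.graft (.single _) (.single _) h (by simpa using fun e => hx (by simp [e]))
  | @graft r s A B hA hB hrs hd ihA ihB =>
    rw [Finset.mem_union, not_or] at hx
    rcases Finset.mem_union.1 hv with hv | hv
    · have := GolabTree.graft (ihA hv hx.1) hB hrs (by
        rw [Finset.disjoint_union_left]
        exact ⟨hd, by simpa using hx.2⟩)
      rwa [Finset.union_right_comm] at this
    · have := GolabTree.graft hA (ihB hv hx.2) hrs (by
        rw [Finset.disjoint_union_right]
        exact ⟨hd, by simpa using hx.1⟩)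
      rwa [← Finset.union_assoc] at this

theorem golab_cluster {X : Type*} [MetricSpace X] {ι : Type} [DecidableEq ι]
    (U : ι → Set X) (w : ι → ℝ) (hw : ∀ i, Metric.ediam (U i) ≤ ENNReal.ofReal (w i))
    (hw0 : ∀ i, 0 ≤ w i) {δ η : ℝ} (hwη : ∀ i, w i ≤ η) (hηδ : η < δ) {r : ι} {A : Finset ι}
    (hT : GolabTree (fun i j => (U i ∩ U j).Nonempty) r A) :
    ∃ (C : List (Set X × ℝ)) (R : Set X) (ρ : ℝ),
      (∀ i ∈ A, ∀ x ∈ U i, x ∈ R ∨ ∃ p ∈ C, x ∈ p.1) ∧ U r ⊆ R ∧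
      Metric.ediam R ≤ ENNReal.ofReal ρ ∧ 0 ≤ ρ ∧ ρ < δ ∧
      (∀ p ∈ C, Metric.ediam p.1 ≤ ENNReal.ofReal p.2 ∧ 0 ≤ p.2 ∧ p.2 ≤ 2 * δ) ∧
      (C.map Prod.snd).sum + ρ ≤ ∑ i ∈ A, w i + C.length * η ∧
      C.length * δ + ρ ≤ ∑ i ∈ A, w i + C.length * η := by
  induction hT with
  | single r =>
    refine ⟨[], U r, w r, ?_, subset_rfl, hw r, hw0 r, (hwη r).trans_lt hηδ, ?_, ?_, ?_⟩ <;> simp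
  | @graft r s A B hA hB hrs hd ihA ihB =>
    obtain ⟨C₁, R₁, ρ₁, hc₁, hr₁, hd₁, h0₁, hδ₁, hC₁, hs₁, hl₁⟩ := ihA
    obtain ⟨C₂, R₂, ρ₂, hc₂, hr₂, hd₂, h0₂, hδ₂, hC₂, hs₂, hl₂⟩ := ihB
    have hdR : Metric.ediam (R₁ ∪ R₂) ≤ ENNReal.ofReal (ρ₁ + ρ₂) := by
      rw [ENNReal.ofReal_add h0₁ h0₂]
      exact (Metric.ediam_union_le (hrs.mono (Set.inter_subset_inter hr₁ hr₂))).trans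
        (add_le_add hd₁ hd₂)
    have hsum : ∑ i ∈ A ∪ B, w i = ∑ i ∈ A, w i + ∑ i ∈ B, w i := Finset.sum_union hd
    by_cases hlt : ρ₁ + ρ₂ < δ
    · refine ⟨C₁ ++ C₂, R₁ ∪ R₂, ρ₁ + ρ₂, ?_, hr₁.trans Set.subset_union_left, hdR, by linarith,
        hlt, ?_, ?_, ?_⟩
      · intro i hi x hx
        rcases Finset.mem_union.1 hi with hi | hi
        · rcases hc₁ i hi x hx with h | ⟨p, hp, h⟩
          · exact .inl (.inl h)
          · exact .inr ⟨p, by simp [hp], h⟩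
        · rcases hc₂ i hi x hx with h | ⟨p, hp, h⟩
          · exact .inl (.inr h)
          · exact .inr ⟨p, by simp [hp], h⟩
      · intro p hp
        rcases List.mem_append.1 hp with hp | hp
        exacts [hC₁ p hp, hC₂ p hp]
      · rw [hsum, List.map_append, List.sum_append, List.length_append]
        push_cast
        linarith
      · rw [hsum, List.length_append]
        push_cast
        linarith
    · push Not at hlt
      have hη := hwη r
      refine ⟨(R₁ ∪ R₂, ρ₁ + ρ₂) :: (C₁ ++ C₂), U r, w r, ?_, subset_rfl, hw r, hw0 r,
        by linarith, ?_, ?_, ?_⟩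
      · intro i hi x hx
        right
        rcases Finset.mem_union.1 hi with hi | hi
        · rcases hc₁ i hi x hx with h | ⟨p, hp, h⟩
          · exact ⟨_, List.mem_cons_self, .inl h⟩
          · exact ⟨p, by simp [hp], h⟩
        · rcases hc₂ i hi x hx with h | ⟨p, hp, h⟩
          · exact ⟨_, List.mem_cons_self, .inr h⟩
          · exact ⟨p, by simp [hp], h⟩
      · intro p hp
        rcases List.mem_cons.1 hp with rfl | hp
        · exact ⟨hdR, by positivity, by dsimp only; linarith⟩
        rcases List.mem_append.1 hp with hp | hp
        exacts [hC₁ p hp, hC₂ p hp]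
      · rw [hsum, List.map_cons, List.map_append, List.sum_cons, List.sum_append,
          List.length_cons, List.length_append]
        push_cast
        linarith
      · rw [hsum, List.length_cons, List.length_append]
        push_cast
        linarith

theorem golab_open_cover {X : Type*} [MetricSpace X] [MeasurableSpace X] [BorelSpace X]
    {S : Set X} (hS : IsCompact S) {c : ℝ} (hc : μH[1] S < ENNReal.ofReal c) {η : ℝ}
    (hη : 0 < η) :
    ∃ (U : ℕ → Set X) (w : ℕ → ℝ) (t : Finset ℕ), (∀ i, IsOpen (U i)) ∧
      (∀ i, Metric.ediam (U i) ≤ ENNReal.ofReal (w i)) ∧ (∀ i, 0 ≤ w i) ∧ (∀ i, w i ≤ η) ∧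
      (∀ i ∈ t, (S ∩ U i).Nonempty) ∧ (S ⊆ ⋃ i ∈ t, U i) ∧ ∑ i ∈ t, w i ≤ c := by
  classical
  have hc0 : 0 < c := ENNReal.ofReal_pos.1 (pos_of_gt hc)
  rw [Measure.hausdorffMeasure_apply] at hc
  have h1 := (le_iSup₂ (f := fun (r : ENNReal) (_ : 0 < r) =>
      ⨅ (t : ℕ → Set X) (_ : S ⊆ ⋃ n, t n) (_ : ∀ n, Metric.ediam (t n) ≤ r),
          ∑' n, ⨆ _ : (t n).Nonempty, Metric.ediam (t n) ^ (1 : ℝ)) (ENNReal.ofReal (η / 2))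
      (ENNReal.ofReal_pos.2 (by positivity))).trans_lt hc
  simp only [iInf_lt_iff] at h1
  obtain ⟨V, hV, hVd, hVs⟩ := h1
  have hVs' : ∑' n, Metric.ediam (V n) < ENNReal.ofReal c := by
    refine lt_of_le_of_lt (ENNReal.tsum_le_tsum fun n => ?_) hVs
    rcases (V n).eq_empty_or_nonempty with h | h
    · simp [h]
    · simp [h]
  set T := ∑' n, Metric.ediam (V n) with hTdef
  have hpos : min ((ENNReal.ofReal c - T) / 2) (ENNReal.ofReal (η / 4)) ≠ 0 := by
    refine (lt_min (ENNReal.div_pos (tsub_pos_of_lt hVs').ne' (by simp))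
      (ENNReal.ofReal_pos.2 (by positivity))).ne'
  obtain ⟨e, he0, hes⟩ := ENNReal.exists_pos_sum_of_countable hpos ℕ
  have hes1 := hes.trans_le (min_le_left _ _)
  have hes2 := hes.trans_le (min_le_right _ _)
  have htot : ∑' n, (Metric.ediam (V n) + 2 * (e n : ENNReal)) ≤ ENNReal.ofReal c := by
    rw [ENNReal.tsum_add, ENNReal.tsum_mul_left, ← hTdef]
    have : 2 * ∑' n, (e n : ENNReal) ≤ ENNReal.ofReal c - T := by
      calc _ ≤ 2 * ((ENNReal.ofReal c - T) / 2) := by gcongr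
        _ = _ := ENNReal.mul_div_cancel (by simp) (by simp)
    calc _ ≤ T + (ENNReal.ofReal c - T) := by gcongr
      _ = _ := add_tsub_cancel_of_le hVs'.le
  have hle : ∀ n, Metric.ediam (V n) + 2 * (e n : ENNReal) ≤ ENNReal.ofReal η := by
    intro n
    have : (e n : ENNReal) ≤ ENNReal.ofReal (η / 4) := (ENNReal.le_tsum n).trans hes2.le
    calc _ ≤ ENNReal.ofReal (η / 2) + 2 * ENNReal.ofReal (η / 4) := by
            gcongr
            exact hVd n
      _ = ENNReal.ofReal η := by
        rw [← ENNReal.ofReal_ofNat, ← ENNReal.ofReal_mul (by norm_num),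
          ← ENNReal.ofReal_add (by positivity) (by positivity)]
        congr 1
        ring
  have hne : ∀ n, Metric.ediam (V n) + 2 * (e n : ENNReal) ≠ ⊤ := fun n =>
    ne_top_of_le_ne_top ENNReal.ofReal_ne_top (hle n)
  obtain ⟨t, ht⟩ := hS.elim_finite_subcover (fun n => Metric.thickening (e n) (V n))
    (fun n => Metric.isOpen_thickening) (hV.trans (Set.iUnion_mono fun n =>
      Metric.self_subset_thickening (by exact_mod_cast he0 n) _))
  refine ⟨fun n => Metric.thickening (e n) (V n),
    fun n => (Metric.ediam (V n) + 2 * (e n : ENNReal)).toReal,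
    t.filter fun n => (S ∩ Metric.thickening (e n) (V n)).Nonempty,
    fun n => Metric.isOpen_thickening, ?_, fun n => ENNReal.toReal_nonneg, ?_, ?_, ?_, ?_⟩
  · intro n
    rw [ENNReal.ofReal_toReal (hne n)]
    exact Metric.ediam_thickening_le _
  · intro n
    exact ENNReal.toReal_le_of_le_ofReal hη.le (hle n)
  · intro i hi
    exact (Finset.mem_filter.1 hi).2
  · intro x hx
    obtain ⟨i, hi, hxi⟩ := Set.mem_iUnion₂.1 (ht hx)
    exact Set.mem_iUnion₂.2 ⟨i, Finset.mem_filter.2 ⟨hi, x, hx, hxi⟩, hxi⟩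
  · rw [← ENNReal.toReal_sum fun n _ => hne n]
    exact ENNReal.toReal_le_of_le_ofReal hc0.le ((ENNReal.sum_le_tsum _).trans htot)

theorem golab_tree_exists {X : Type*} [MetricSpace X] {S : Set X} (hS : IsConnected S)
    (U : ℕ → Set X) (hU : ∀ i, IsOpen (U i)) (t : Finset ℕ) (ht : ∀ i ∈ t, (S ∩ U i).Nonempty)
    (hcov : S ⊆ ⋃ i ∈ t, U i) :
    ∃ r, GolabTree (fun i j => (U i ∩ U j).Nonempty) r t := by
  classical
  obtain ⟨x, hx⟩ := hS.nonempty
  obtain ⟨r, hr, hxr⟩ := Set.mem_iUnion₂.1 (hcov hx)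
  refine ⟨r, ?_⟩
  obtain ⟨A, hA, hmax⟩ := Finset.exists_max_image
    (t.powerset.filter fun A => GolabTree (fun i j => (U i ∩ U j).Nonempty) r A)
    Finset.card ⟨{r}, by simp [hr, GolabTree.single]⟩
  rw [Finset.mem_filter, Finset.mem_powerset] at hA
  by_cases hAt : t ⊆ A
  · rw [← hA.1.antisymm hAt]
    exact hA.2
  exfalso
  obtain ⟨j, hjt, hjA⟩ := Finset.not_subset.1 hAt
  have hAne : A.Nonempty := by
    rw [Finset.nonempty_iff_ne_empty]
    rintro rfl
    have := hmax {r} (by simp [hr, GolabTree.single])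
    simp at this
  obtain ⟨i, hi⟩ := hAne
  have := hS.isPreconnected (⋃ i ∈ A, U i) (⋃ i ∈ t \ A, U i)
    (isOpen_biUnion fun i _ => hU i) (isOpen_biUnion fun i _ => hU i)
    (by
      intro y hy
      obtain ⟨k, hk, hyk⟩ := Set.mem_iUnion₂.1 (hcov hy)
      by_cases hkA : k ∈ A
      · exact .inl (Set.mem_iUnion₂.2 ⟨k, hkA, hyk⟩)
      · exact .inr (Set.mem_iUnion₂.2 ⟨k, Finset.mem_sdiff.2 ⟨hk, hkA⟩, hyk⟩))
    (by
      obtain ⟨y, hy, hyi⟩ := ht i (hA.1 hi)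
      exact ⟨y, hy, Set.mem_iUnion₂.2 ⟨i, hi, hyi⟩⟩)
    (by
      obtain ⟨y, hy, hyi⟩ := ht j hjt
      exact ⟨y, hy, Set.mem_iUnion₂.2 ⟨j, Finset.mem_sdiff.2 ⟨hjt, hjA⟩, hyi⟩⟩)
  obtain ⟨y, -, hy1, hy2⟩ := this
  obtain ⟨a, ha, hya⟩ := Set.mem_iUnion₂.1 hy1
  obtain ⟨b, hb, hyb⟩ := Set.mem_iUnion₂.1 hy2
  rw [Finset.mem_sdiff] at hb
  have hT := hA.2.add_leaf ha hb.2 ⟨y, hya, hyb⟩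
  have := hmax (A ∪ {b}) (by
    rw [Finset.mem_filter, Finset.mem_powerset]
    exact ⟨Finset.union_subset hA.1 (by simpa using hb.1), hT⟩)
  rw [Finset.card_union_of_disjoint (by simpa using hb.2)] at this
  simp at this

theorem golab_cover {X : Type*} [MetricSpace X] [MeasurableSpace X] [BorelSpace X]
    {S : Set X} (hS : IsCompact S) (hSc : IsConnected S) {c : ℝ}
    (hc : μH[1] S < ENNReal.ofReal c) {δ η : ℝ} (hη : 0 < η) (hηδ : η < δ) :
    ∃ C : List (Set X × ℝ), (∀ x ∈ S, ∃ p ∈ C, x ∈ p.1) ∧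
      (∀ p ∈ C, Metric.ediam p.1 ≤ ENNReal.ofReal p.2 ∧ 0 ≤ p.2 ∧ p.2 ≤ 2 * δ) ∧
      (C.map Prod.snd).sum ≤ c + C.length * η ∧
      (C.length - 1) * δ ≤ c + C.length * η := by
  obtain ⟨U, w, t, hU, hw, hw0, hwη, ht, hcov, hsum⟩ := golab_open_cover hS hc hη
  obtain ⟨r, hT⟩ := golab_tree_exists hSc U hU t ht hcov
  obtain ⟨C, R, ρ, h1, -, h3, h4, h5, h6, h7, h8⟩ := golab_cluster U w hw hw0 hwη hηδ hT
  refine ⟨(R, ρ) :: C, ?_, ?_, ?_, ?_⟩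
  · intro x hx
    obtain ⟨i, hi, hxi⟩ := Set.mem_iUnion₂.1 (hcov hx)
    rcases h1 i hi x hxi with h | ⟨p, hp, h⟩
    · exact ⟨_, List.mem_cons_self, h⟩
    · exact ⟨p, by simp [hp], h⟩
  · intro p hp
    rcases List.mem_cons.1 hp with rfl | hp
    · exact ⟨h3, h4, by dsimp only; linarith⟩
    · exact h6 p hp
  · rw [List.map_cons, List.sum_cons, List.length_cons]
    push_cast
    linarith
  · rw [List.length_cons]
    push_cast
    linarith

theorem golab_limit_cover {X : Type*} [MetricSpace X] [MeasurableSpace X] [BorelSpace X]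
    {S : ℕ → Set X} {S₀ : Set X} (hS : ∀ n, IsCompact (S n)) (hSc : ∀ n, IsConnected (S n))
    (hconv : ∀ θ : ℝ, 0 < θ → ∀ᶠ n in atTop, ∀ x ∈ S₀, ∃ y ∈ S n, dist y x < θ) {c : ℝ}
    (hc0 : 0 ≤ c)
    (hc : ∃ᶠ n in atTop, μH[1] (S n) < ENNReal.ofReal c) {δ : ℝ} (hδ : 0 < δ) :
    ∃ (k : ℕ) (F : Fin k → Set X), S₀ ⊆ ⋃ i, F i ∧
      (∀ i, Metric.ediam (F i) ≤ ENNReal.ofReal (3 * δ)) ∧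
      ∑ i, Metric.ediam (F i) ≤ ENNReal.ofReal (c + 2 * δ) := by
  set N : ℝ := 2 * (c + δ) / δ with hN
  have hN0 : 0 < N := by positivity
  set η : ℝ := min (δ / 2) (δ / N) with hη
  have hη0 : 0 < η := by positivity
  have hη1 : η ≤ δ / 2 := min_le_left _ _
  have hη2 : N * η ≤ δ := by
    have : η ≤ δ / N := min_le_right _ _
    rw [le_div_iff₀ hN0] at this
    linarith
  obtain ⟨n, hn, hn2⟩ := (hc.and_eventually (hconv (η / 2) (by positivity))).exists
  obtain ⟨C, h1, h2, h3, h4⟩ := golab_cover (hS n) (hSc n) hn hη0 (by linarith : η < δ)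
  have hlen : (C.length : ℝ) ≤ N := by
    rw [hN, le_div_iff₀ hδ]
    have : (C.length : ℝ) * η ≤ C.length * (δ / 2) := by gcongr
    linarith
  have hlen2 : (C.length : ℝ) * η ≤ δ := (by gcongr : (C.length : ℝ) * η ≤ N * η).trans hη2
  have hd : ∀ p ∈ C, Metric.ediam (Metric.thickening (η / 2) p.1) ≤ ENNReal.ofReal (p.2 + η) := by
    intro p hp
    have h := Metric.ediam_thickening_le (s := p.1) (Real.toNNReal (η / 2))
    rw [Real.coe_toNNReal _ (by positivity)] at h
    have e : (2 : ENNReal) * ((Real.toNNReal (η / 2) : NNReal) : ENNReal) = ENNReal.ofReal η := by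
      change (2 : ENNReal) * ENNReal.ofReal (η / 2) = _
      rw [← ENNReal.ofReal_ofNat, ← ENNReal.ofReal_mul (by norm_num)]
      congr 1
      ring
    rw [e] at h
    rw [ENNReal.ofReal_add (h2 p hp).2.1 hη0.le]
    exact h.trans (add_le_add (h2 p hp).1 le_rfl)
  refine ⟨C.length, fun i => Metric.thickening (η / 2) (C[i]).1, ?_, ?_, ?_⟩
  · intro x hx
    obtain ⟨y, hy, hxy⟩ := hn2 x hx
    obtain ⟨p, hp, hyp⟩ := h1 y hy
    obtain ⟨i, hi, rfl⟩ := List.getElem_of_mem hp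
    exact Set.mem_iUnion.2 ⟨⟨i, hi⟩, Metric.mem_thickening_iff.2 ⟨y, hyp, by rwa [dist_comm]⟩⟩
  · intro i
    refine (hd _ (List.getElem_mem _)).trans (ENNReal.ofReal_le_ofReal ?_)
    have := (h2 _ (List.getElem_mem i.2)).2.2
    linarith
  · calc _ ≤ ∑ i : Fin C.length, ENNReal.ofReal ((C[i]).2 + η) :=
          Finset.sum_le_sum fun i _ => hd _ (List.getElem_mem _)
      _ = ENNReal.ofReal (∑ i : Fin C.length, ((C[i]).2 + η)) := by
          rw [ENNReal.ofReal_sum_of_nonneg]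
          intro i _
          have := (h2 _ (List.getElem_mem i.2)).2.1
          simp only [Fin.getElem_fin]
          linarith
      _ ≤ _ := by
          apply ENNReal.ofReal_le_ofReal
          rw [Finset.sum_add_distrib]
          have : ∑ i : Fin C.length, (C[i]).2 = (C.map Prod.snd).sum := by
            simp
          rw [this]
          simp only [Finset.sum_const, Finset.card_univ, Fintype.card_fin, nsmul_eq_mul]
          linarith

/-- Gołąb's theorem in the plane: `H¹` is lower semicontinuous along
Hausdorff-converging sequences of closed connected sets (all contained in a
fixed compact set). -/
theorem golab_lower_semicontinuity {K : Set (EuclideanSpace ℝ (Fin 2))}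
    (hK : IsCompact K) (S : ℕ → Set (EuclideanSpace ℝ (Fin 2)))
    (S₀ : Set (EuclideanSpace ℝ (Fin 2)))
    (hScl : ∀ n, IsClosed (S n)) (hSconn : ∀ n, IsConnected (S n))
    (hSK : ∀ n, S n ⊆ K) (hS₀K : S₀ ⊆ K) (hS₀cl : IsClosed S₀)
    (hconv : Tendsto (fun n => Metric.hausdorffDist (S n) S₀) atTop (𝓝 0)) :
    μH[1] S₀ ≤ atTop.liminf fun n => μH[1] (S n) := by
  rcases S₀.eq_empty_or_nonempty with rfl | hne
  · simp
  have hconv' : ∀ θ : ℝ, 0 < θ → ∀ᶠ n in atTop, ∀ x ∈ S₀, ∃ y ∈ S n, dist y x < θ := by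
    intro θ hθ
    filter_upwards [hconv.eventually_lt_const hθ] with n hn x hx
    exact Metric.exists_dist_lt_of_hausdorffDist_lt' hx hn
      (Metric.hausdorffEDist_ne_top_of_nonempty_of_bounded (hSconn n).nonempty hne
        (hK.isBounded.subset (hSK n)) (hK.isBounded.subset hS₀K))
  refine le_of_forall_gt_imp_ge_of_dense fun b hb => ?_
  obtain ⟨c, hc1, hc2⟩ := ENNReal.lt_iff_exists_nnreal_btwn.1 hb
  refine le_trans ?_ hc2.le
  have hfr := frequently_lt_of_liminf_lt (h := hc1)
  rw [← ENNReal.ofReal_coe_nnreal] at hfr ⊢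
  have key := fun m : ℕ => golab_limit_cover (fun n => hK.of_isClosed_subset (hScl n) (hSK n))
    hSconn hconv' c.2 hfr (δ := 1 / ((m : ℝ) + 1)) (by positivity)
  choose k F hF1 hF2 hF3 using key
  have hlim := tendsto_one_div_add_atTop_nhds_zero_nat (𝕜 := ℝ)
  have ht1 : Tendsto (fun m : ℕ => ENNReal.ofReal (3 * (1 / ((m : ℝ) + 1)))) atTop (𝓝 0) := by
    have := ENNReal.tendsto_ofReal (hlim.const_mul 3)
    simpa using this
  have ht2 : Tendsto (fun m : ℕ => ENNReal.ofReal (c + 2 * (1 / ((m : ℝ) + 1)))) atTop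
      (𝓝 (ENNReal.ofReal c)) := by
    have := ENNReal.tendsto_ofReal ((hlim.const_mul 2).const_add (c : ℝ))
    simpa using this
  refine (Measure.hausdorffMeasure_le_liminf_sum 1 S₀ _ ht1 F (.of_forall hF2)
    (.of_forall hF1)).trans ?_
  rw [← ht2.liminf_eq]
  refine liminf_le_liminf (.of_forall fun m => ?_)
  simp only [ENNReal.rpow_one]
  exact hF3 m
end
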